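/- arXiv:2306.11995 — 5 statements merged into one kernel-verified Lean document; each statement's English description precedes it below -/
import Mathlib

section
/- For all integers d ≥ 0 and ℓ ≥ k ≥ 3, there exists a finite simple graph G that is (k,d,ℓ)-choosable but not (k,d,ℓ+1)-choosable. -/
/-- The defect of vertex `v` under coloring `φ`: the number of neighbors of `v`
receiving the same color as `v`. -/
noncomputable def defect {V : Type*} (G : SimpleGraph V) (φ : V → ℕ) (v : V) : ℕ :=
  {w | G.Adj v w ∧ φ w = φ v}.ncard

/-- `G` is `(k,d,p)`-choosable: for every list assignment with lists of size at least `k`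
whose union of lists has at most `p` colors, there is a `d`-defective coloring from the lists. -/
def Choosable {V : Type*} [Fintype V] (G : SimpleGraph V) (k d p : ℕ) : Prop :=
  ∀ L : V → Finset ℕ, (∀ v, k ≤ (L v).card) → (Finset.univ.biUnion L).card ≤ p →
    ∃ φ : V → ℕ, (∀ v, φ v ∈ L v) ∧ ∀ v, defect G φ v ≤ d

open Finset

section Cone

variable {V N : Type*}

/-- Disjoint copies of `G` indexed by `N`, together with an apex adjacent to all copies
of the vertices in `S`. -/
def coneGraph (N : Type*) (G : SimpleGraph V) (S : Set V) : SimpleGraph (Option (N × V)) where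
  Adj
    | none, none => False
    | none, some p => p.2 ∈ S
    | some p, none => p.2 ∈ S
    | some p, some q => p.1 = q.1 ∧ G.Adj p.2 q.2
  symm := ⟨by
    rintro (_ | p) (_ | q) h
    · exact h
    · exact h
    · exact h
    · exact ⟨h.1.symm, h.2.symm⟩⟩
  loopless := ⟨by
    rintro (_ | p) h
    · exact h
    · exact G.loopless.irrefl _ h.2⟩

/-- The coloring of a cone given by a color of the apex and a coloring of each copy. -/
def coneColoring (a : ℕ) (φ : N → V → ℕ) (x : Option (N × V)) : ℕ :=
  x.elim a fun p => φ p.1 p.2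

theorem defect_coneColoring_le [Finite V] {G : SimpleGraph V} {S : Set V} {a d : ℕ}
    {φ : N → V → ℕ} (hS : ∀ n, ∀ v ∈ S, φ n v ≠ a) (hφ : ∀ n v, defect G (φ n) v ≤ d)
    (x : Option (N × V)) : defect (coneGraph N G S) (coneColoring a φ) x ≤ d := by
  rcases x with _ | ⟨n, v⟩
  · have : {w | (coneGraph N G S).Adj none w ∧ coneColoring a φ w = coneColoring a φ none} = ∅ := by
      ext w
      rcases w with _ | ⟨n, v⟩
      · simp [coneGraph]
      · simpa [coneGraph, coneColoring] using fun h => hS n v h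
    simp [defect, this]
  · refine le_trans ?_ (hφ n v)
    unfold defect
    refine le_trans (Set.ncard_le_ncard (t := (fun w => some (n, w)) ''
      {w | G.Adj v w ∧ φ n w = φ n v}) ?_ (Set.toFinite _)) (Set.ncard_image_le (Set.toFinite _))
    rintro (_ | ⟨m, w⟩) ⟨h, h'⟩
    · exact absurd h'.symm (hS n v h)
    · obtain ⟨rfl, h⟩ := h
      exact ⟨w, ⟨h, h'⟩, rfl⟩

theorem defect_copy_le [Finite V] [Finite N] (G : SimpleGraph V) (S : Set V)
    (φ : Option (N × V) → ℕ) (n : N) (v : V) :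
    defect G (fun w => φ (some (n, w))) v ≤ defect (coneGraph N G S) φ (some (n, v)) := by
  unfold defect
  rw [← Set.ncard_image_of_injective (f := fun w => (some (n, w) : Option (N × V))) _
    (fun a b h => by simpa using h)]
  refine Set.ncard_le_ncard ?_ (Set.toFinite _)
  rintro _ ⟨w, ⟨h, h'⟩, rfl⟩
  exact ⟨⟨rfl, h⟩, h'⟩

theorem exists_copy_avoiding_apex [Finite V] {M : Type*} [Finite M] {G : SimpleGraph V}
    {S : Set V} {d : ℕ} {φ : Option ((M × Fin (d + 1)) × V) → ℕ}
    (hφ : defect (coneGraph (M × Fin (d + 1)) G S) φ none ≤ d) (m : M) :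
    ∃ j, ∀ v ∈ S, φ (some ((m, j), v)) ≠ φ none := by
  by_contra! h
  choose f hf hf' using h
  have hinj : Function.Injective
      (fun j => (some ((m, j), f j) : Option ((M × Fin (d + 1)) × V))) := by
    intro i j hij
    simp only [Option.some.injEq, Prod.mk.injEq] at hij
    exact hij.1.2
  have h1 : (Set.range fun j => (some ((m, j), f j) : Option ((M × Fin (d + 1)) × V))).ncard
      ≤ d := by
    refine le_trans (Set.ncard_le_ncard ?_ (Set.toFinite _)) hφ
    rintro _ ⟨j, rfl⟩
    exact ⟨hf j, hf' j⟩
  rw [← Set.image_univ, Set.ncard_image_of_injective _ hinj] at h1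
  simp at h1

end Cone

/-- A uniform version of being `(k,d,ℓ)`-choosable but not `(k,d,ℓ+1)`-choosable, in which bad
lists exist inside every palette of `ℓ + 1` colors. -/
def Separates {V : Type*} (G : SimpleGraph V) (k d ℓ : ℕ) : Prop :=
  (∀ P : Finset ℕ, P.card ≤ ℓ → ∀ L : V → Finset ℕ, (∀ v, k ≤ (L v).card) → (∀ v, L v ⊆ P) →
    ∃ φ : V → ℕ, (∀ v, φ v ∈ L v) ∧ ∀ v, defect G φ v ≤ d) ∧
  ∀ P : Finset ℕ, P.card = ℓ + 1 → ∃ L : V → Finset ℕ, (∀ v, k ≤ (L v).card) ∧ (∀ v, L v ⊆ P) ∧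
    ¬ ∃ φ : V → ℕ, (∀ v, φ v ∈ L v) ∧ ∀ v, defect G φ v ≤ d

theorem Separates.choosable {V : Type*} [Fintype V] {G : SimpleGraph V} {k d ℓ : ℕ}
    (h : Separates G k d ℓ) : Choosable G k d ℓ ∧ ¬ Choosable G k d (ℓ + 1) := by
  refine ⟨fun L hk hL => h.1 _ hL L hk fun v => subset_biUnion_of_mem L (mem_univ v), fun h' => ?_⟩
  obtain ⟨L, hk, hL, hbad⟩ := h.2 (range (ℓ + 1)) (card_range _)
  exact hbad (h' L hk ((card_le_card (biUnion_subset.2 fun v _ => hL v)).trans (card_range _).le))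

/-- Joining an apex to sufficiently many copies of a separating graph increases both the list
size and the number of colors by one. -/
theorem Separates.cone {V : Type*} [Finite V] {G : SimpleGraph V} {k d ℓ : ℕ}
    (hkℓ : k ≤ ℓ) (h : Separates G k d ℓ) :
    Separates (coneGraph (Fin (k + 1) × Fin (d + 1)) G Set.univ) (k + 1) d (ℓ + 1) := by
  constructor
  · intro P hP L hk hL
    obtain ⟨a, ha⟩ : (L none).Nonempty := card_pos.1 (by have := hk none; omega)
    have haP := hL _ ha
    have key (n) : ∃ φ : V → ℕ, (∀ v, φ v ∈ (L (some (n, v))).erase a) ∧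
        ∀ v, defect G φ v ≤ d := by
      refine h.1 (P.erase a) (by rw [card_erase_of_mem haP]; omega) _ (fun v => ?_)
        fun v => erase_subset_erase _ (hL _)
      have h1 := pred_card_le_card_erase (s := L (some (n, v))) (a := a)
      have h2 := hk (some (n, v))
      omega
    choose φ hφ hd using key
    refine ⟨coneColoring a φ, ?_, defect_coneColoring_le (fun n v _ => (mem_erase.1 (hφ n v)).1) hd⟩
    rintro (_ | ⟨n, v⟩)
    · exact ha
    · exact (mem_erase.1 (hφ n v)).2
  · intro P hP
    obtain ⟨X, hXP, hX⟩ := exists_subset_card_eq (show k + 1 ≤ P.card by omega)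
    let e := X.equivFinOfCardEq hX
    have key (x : X) := h.2 (P.erase x) (by rw [card_erase_of_mem (hXP x.2)]; omega)
    choose L hk hL hbad using key
    have hnot (x : X) (v) : (x : ℕ) ∉ L x v := fun hx => (mem_erase.1 (hL x v hx)).1 rfl
    refine ⟨fun y => y.elim X fun p => insert ↑(e.symm p.1.1) (L (e.symm p.1.1) p.2), ?_, ?_, ?_⟩
    · rintro (_ | ⟨n, v⟩)
      · exact hX.ge
      · simpa [card_insert_of_notMem (hnot _ v)] using hk _ v
    · rintro (_ | ⟨n, v⟩)
      · exact hXP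
      · exact insert_subset (hXP (e.symm n.1).2) ((hL _ v).trans (erase_subset _ _))
    · rintro ⟨φ, hφ, hd⟩
      let x : X := ⟨φ none, hφ none⟩
      obtain ⟨j, hj⟩ := exists_copy_avoiding_apex (hd none) (e x)
      refine hbad x ⟨fun v => φ (some ((e x, j), v)), fun v => ?_,
        fun v => (defect_copy_le _ _ _ _ _).trans (hd _)⟩
      have h1 := hφ (some ((e x, j), v))
      simp only [Option.elim_some, Equiv.symm_apply_apply, mem_insert] at h1
      exact h1.resolve_left (hj v trivial)

/-- `φ` is a `d`-defective coloring of `G` from the lists `L` when every vertex `v` also has to avoid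
the colors `c i` of its terminals `i ∈ att v`. -/
def IsExtension {V : Type*} (G : SimpleGraph V) (att : V → Set ℕ) (d : ℕ) (c : ℕ → ℕ)
    (L : V → Finset ℕ) (φ : V → ℕ) : Prop :=
  (∀ v, φ v ∈ L v) ∧ (∀ v, ∀ i ∈ att v, φ v ≠ c i) ∧ ∀ v, defect G φ v ≤ d

/-- `G`, attached to `j` of `t` terminals, tests whether the terminals are rainbow: colorings of the
terminals from a palette of `t + 1` colors extend to `G`, except possibly when `j = t` and all
terminals have distinct colors, while inside every palette of `t + 2` colors there are lists to
which no rainbow coloring of the terminals extends. -/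
structure TestsRainbow {V : Type*} (G : SimpleGraph V) (att : V → Set ℕ) (d t j : ℕ) : Prop where
  lt_of_mem : ∀ v, ∀ i ∈ att v, i < j
  exists_isExtension : ∀ P : Finset ℕ, P.card ≤ t + 1 → ∀ c : ℕ → ℕ, (∀ i < j, c i ∈ P) →
    (j = t → ¬ Set.InjOn c (Set.Iio j)) → ∀ L : V → Finset ℕ, (∀ v, 3 ≤ (L v).card) →
    (∀ v, L v ⊆ P) → ∃ φ, IsExtension G att d c L φ
  exists_bad : ∀ P : Finset ℕ, P.card = t + 2 → ∀ c : ℕ → ℕ, (∀ i < j, c i ∈ P) →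
    Set.InjOn c (Set.Iio j) → ∃ L : V → Finset ℕ, (∀ v, 3 ≤ (L v).card) ∧ (∀ v, L v ⊆ P) ∧
    ¬ ∃ φ, IsExtension G att d c L φ

theorem TestsRainbow.separates {V : Type*} {G : SimpleGraph V} {att : V → Set ℕ} {d t : ℕ}
    (ht : 0 < t) (h : TestsRainbow G att d t 0) : Separates G 3 d (t + 1) := by
  constructor
  · intro P hP L hk hL
    obtain ⟨φ, h1, -, h2⟩ := h.exists_isExtension P hP id (by simp) (by omega) L hk hL
    exact ⟨φ, h1, h2⟩
  · intro P hP
    obtain ⟨L, hk, hL, hbad⟩ := h.exists_bad P hP id (by simp) (by simp)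
    exact ⟨L, hk, hL, fun ⟨φ, h1, h2⟩ =>
      hbad ⟨φ, h1, fun v i hi => absurd (h.lt_of_mem v i hi) (by omega), h2⟩⟩

/-- The terminals of the copies of a graph in a cone whose apex is the terminal `j`. -/
def coneAtt {V : Type*} (N : Type*) (att : V → Set ℕ) (j : ℕ) (x : Option (N × V)) : Set ℕ :=
  x.elim ∅ fun p => att p.2 \ {j}

/-- The last terminal may be turned into an apex. -/
theorem TestsRainbow.cone {V : Type*} [Finite V] {G : SimpleGraph V} {att : V → Set ℕ} {d t j : ℕ}
    (hj : j < t) (h : TestsRainbow G att d t (j + 1)) :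
    TestsRainbow (coneGraph (Fin 3 × Fin (d + 1)) G {v | j ∈ att v}) (coneAtt _ att j) d t j where
  lt_of_mem := by
    rintro (_ | ⟨n, v⟩) i hi
    · exact absurd hi (by simp [coneAtt])
    · have h1 := h.lt_of_mem v i hi.1
      have h2 : i ≠ j := hi.2
      omega
  exists_isExtension := by
    intro P hP c hc _ L hk hL
    obtain ⟨a, ha, haj⟩ : ∃ a ∈ L none,
        (j + 1 = t → ¬ Set.InjOn (Function.update c j a) (Set.Iio (j + 1))) := by
      by_cases hinj : Set.InjOn c (Set.Iio j)
      · by_cases hjt : j + 1 = t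
        · obtain ⟨a, ha, ha'⟩ : ∃ a ∈ L none, a ∈ (range j).image c := by
            by_contra! hne
            have h1 : L none ⊆ P \ (range j).image c :=
              fun a ha => mem_sdiff.2 ⟨hL _ ha, hne a ha⟩
            have h2 := card_le_card h1
            rw [card_sdiff_of_subset (image_subset_iff.2 fun i hi => hc i (mem_range.1 hi)),
              card_image_of_injOn (by simpa using hinj), card_range] at h2
            have := hk none
            omega
          obtain ⟨i, hi, rfl⟩ := mem_image.1 ha'
          rw [mem_range] at hi
          refine ⟨c i, ha, fun _ hinj' => ?_⟩
          have := hinj' (x₁ := i) (x₂ := j) (by simp; omega) (by simp)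
            (by simp [Function.update_of_ne hi.ne])
          omega
        · obtain ⟨a, ha⟩ : (L none).Nonempty := card_pos.1 (by have := hk none; omega)
          exact ⟨a, ha, fun h => absurd h hjt⟩
      · obtain ⟨a, ha⟩ : (L none).Nonempty := card_pos.1 (by have := hk none; omega)
        refine ⟨a, ha, fun _ hinj' => hinj fun x hx y hy hxy => ?_⟩
        rw [Set.mem_Iio] at hx hy
        refine hinj' (by simp; omega) (by simp; omega) ?_
        rwa [Function.update_of_ne hx.ne, Function.update_of_ne hy.ne]
    have key (n) := h.exists_isExtension P hP (Function.update c j a) (fun i hi => by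
      rcases eq_or_ne i j with rfl | hij
      · simpa using hL _ ha
      · rw [Function.update_of_ne hij]
        exact hc i (by omega)) haj (fun v => L (some (n, v))) (fun v => hk _) fun v => hL _
    choose φ hφL hφc hφd using key
    refine ⟨coneColoring a φ, ?_, ?_, defect_coneColoring_le
      (fun n v hv => by simpa using hφc n v j hv) hφd⟩
    · rintro (_ | ⟨n, v⟩)
      · exact ha
      · exact hφL n v
    · rintro (_ | ⟨n, v⟩) i hi
      · exact absurd hi (by simp [coneAtt])
      · have := hφc n v i hi.1
        rwa [Function.update_of_ne hi.2] at this
  exists_bad := by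
    intro P hP c hc hinj
    have hcard : 3 ≤ (P \ (range j).image c).card := by
      rw [card_sdiff_of_subset (image_subset_iff.2 fun i hi => hc i (mem_range.1 hi)),
        card_image_of_injOn (by simpa using hinj), card_range]
      omega
    obtain ⟨X, hXP, hX⟩ := exists_subset_card_eq hcard
    have hXP' (x : X) := mem_sdiff.1 (hXP x.2)
    let e := X.equivFinOfCardEq hX
    have key (x : X) := h.exists_bad P hP (Function.update c j x) (fun i hi => by
      rcases eq_or_ne i j with rfl | hij
      · simpa using (hXP' x).1
      · rw [Function.update_of_ne hij]
        exact hc i (by omega)) (by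
      have hne (i) (hi : i < j) : c i ≠ x := fun hix =>
        (hXP' x).2 (mem_image.2 ⟨i, mem_range.2 hi, hix⟩)
      intro y hy z hz hyz
      rw [Set.mem_Iio] at hy hz
      rcases eq_or_ne y j with hyj | hyj <;> rcases eq_or_ne z j with hzj | hzj
      · exact hyj.trans hzj.symm
      · rw [hyj, Function.update_self, Function.update_of_ne hzj] at hyz
        exact absurd hyz.symm (hne z (by omega))
      · rw [hzj, Function.update_self, Function.update_of_ne hyj] at hyz
        exact absurd hyz (hne y (by omega))
      · rw [Function.update_of_ne hyj, Function.update_of_ne hzj] at hyz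
        exact hinj (by simp; omega) (by simp; omega) hyz)
    choose L hk hL hbad using key
    refine ⟨fun y => y.elim X fun p => L (e.symm p.1.1) p.2, ?_, ?_, ?_⟩
    · rintro (_ | ⟨n, v⟩)
      · exact hX.ge
      · exact hk _ v
    · rintro (_ | ⟨n, v⟩)
      · exact hXP.trans sdiff_subset
      · exact hL _ v
    · rintro ⟨φ, hφ, hφc, hd⟩
      let x : X := ⟨φ none, hφ none⟩
      obtain ⟨i, hi⟩ := exists_copy_avoiding_apex (hd none) (e x)
      refine hbad x ⟨fun v => φ (some ((e x, i), v)), fun v => ?_, fun v m hm => ?_,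
        fun v => (defect_copy_le _ _ _ _ _).trans (hd _)⟩
      · simpa using hφ (some ((e x, i), v))
      · rcases eq_or_ne m j with rfl | hmj
        · simpa using hi v hm
        · rw [Function.update_of_ne hmj]
          exact hφc (some ((e x, i), v)) m ⟨hm, hmj⟩

section Pendant

variable {W : Type*}

/-- The graph `H` with `d` pendant vertices attached to every vertex. -/
def pendantGraph (H : SimpleGraph W) (d : ℕ) : SimpleGraph (W × Option (Fin d)) where
  Adj x y := (x.2 = none ∧ y.2 = none ∧ H.Adj x.1 y.1) ∨
    (x.1 = y.1 ∧ (x.2 = none ∧ y.2 ≠ none ∨ x.2 ≠ none ∧ y.2 = none))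
  symm := ⟨by
    rintro x y (⟨h1, h2, h3⟩ | ⟨h1, h2⟩)
    · exact Or.inl ⟨h2, h1, h3.symm⟩
    · exact Or.inr ⟨h1.symm, by tauto⟩⟩
  loopless := ⟨by
    rintro x (⟨-, -, h⟩ | ⟨-, h⟩)
    · exact H.loopless.irrefl _ h
    · tauto⟩

theorem defect_pendantGraph_le [Finite W] {H : SimpleGraph W} {d : ℕ}
    {φ : W × Option (Fin d) → ℕ} (hφ : ∀ v w, H.Adj v w → φ (v, none) ≠ φ (w, none))
    (x : W × Option (Fin d)) : defect (pendantGraph H d) φ x ≤ d := by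
  unfold defect
  rcases x with ⟨v, _ | i⟩
  · have h : {w | (pendantGraph H d).Adj (v, none) w ∧ φ w = φ (v, none)} ⊆
        (fun i : Fin d => (v, some i)) '' Set.univ := by
      rintro ⟨w, _ | i⟩ ⟨h, h'⟩
      · rcases h with ⟨-, -, h⟩ | ⟨-, h⟩
        · exact absurd h'.symm (hφ _ _ h)
        · simp at h
      · rcases h with ⟨-, h, -⟩ | ⟨h, -⟩
        · simp at h
        · obtain rfl : v = w := h
          exact ⟨i, trivial, rfl⟩
    refine (Set.ncard_le_ncard h (Set.toFinite _)).trans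
      ((Set.ncard_image_le (Set.toFinite _)).trans ?_)
    simp
  · have h : {w | (pendantGraph H d).Adj (v, some i) w ∧ φ w = φ (v, some i)} ⊆ {(v, none)} := by
      rintro ⟨w, _ | k⟩ ⟨h, -⟩ <;> simp_all [pendantGraph]
    refine (Set.ncard_le_ncard h (Set.toFinite _)).trans ?_
    rw [Set.ncard_singleton]
    exact Nat.one_le_of_lt i.2

theorem ne_of_pendants_eq [Finite W] {H : SimpleGraph W} {d : ℕ} {φ : W × Option (Fin d) → ℕ}
    {v w : W} (hd : defect (pendantGraph H d) φ (v, none) ≤ d)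
    (hv : ∀ i, φ (v, some i) = φ (v, none)) (hvw : H.Adj v w) : φ (w, none) ≠ φ (v, none) := by
  intro hw
  have hinj : Function.Injective (fun o : Option (Fin d) => (o.elim w fun _ => v, o)) :=
    fun o o' h => (Prod.mk.injEq _ _ _ _ ▸ h).2
  have h1 : (Set.range fun o : Option (Fin d) => (o.elim w fun _ => v, o)).ncard ≤ d := by
    refine le_trans (Set.ncard_le_ncard ?_ (Set.toFinite _)) hd
    rintro _ ⟨_ | i, rfl⟩
    · exact ⟨Or.inl ⟨rfl, rfl, hvw⟩, hw⟩
    · exact ⟨Or.inr ⟨rfl, Or.inl ⟨rfl, by simp⟩⟩, hv i⟩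
  rw [← Set.image_univ, Set.ncard_image_of_injective _ hinj] at h1
  simp at h1

end Pendant

theorem exists_mem_ne_ne {S : Finset ℕ} (hS : 3 ≤ S.card) (x y : ℕ) :
    ∃ s ∈ S, s ≠ x ∧ s ≠ y := by
  by_contra! h
  have h1 : S ⊆ {x, y} := fun s hs => by
    rw [mem_insert, mem_singleton]
    exact or_iff_not_imp_left.2 (h s hs)
  have := (card_le_card h1).trans card_le_two
  omega

theorem card_triple_and_subset {x y z : ℕ} {P : Finset ℕ} (hxy : x ≠ y) (hxz : x ≠ z) (hyz : y ≠ z)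
    (hx : x ∈ P) (hy : y ∈ P) (hz : z ∈ P) : #{x, y, z} = 3 ∧ {x, y, z} ⊆ P :=
  ⟨card_eq_three.2 ⟨x, y, z, hxy, hxz, hyz, rfl⟩, by
    simp [insert_subset_iff, hx, hy, hz]⟩

section Caterpillar

/-- The tree with a spine `(0, true), …, (n, true)` and leaves `(i, false)`, in which the leaf `i` is
attached to the spine vertex `i + 1` for `i < n` and the leaf `n` to the spine vertex `n`. -/
def caterpillar (n : ℕ) : SimpleGraph (Fin (n + 1) × Bool) :=
  SimpleGraph.fromRel fun x y => x.2 = true ∧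
    (y.2 = true ∧ (y.1 : ℕ) = x.1 + 1 ∨ y.2 = false ∧ (x.1 : ℕ) = min ((y.1 : ℕ) + 1) n)

/-- `z` and `y` color the first `m + 1` spine vertices and the first `m` leaves of a caterpillar
from the lists `Z` and `Y`, where the leaf `i` avoids the colors of the terminals `a i` and `b i`
and the spine vertex `0` avoids those of the terminals `0` and `1`. -/
structure IsPrefixColoring (c a b : ℕ → ℕ) (Z Y : ℕ → Finset ℕ) (m : ℕ) (z y : ℕ → ℕ) : Prop where
  spine_mem : ∀ i ≤ m, z i ∈ Z i
  spine_zero : z 0 ≠ c 0 ∧ z 0 ≠ c 1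
  leaf_mem : ∀ i < m, y i ∈ Y i
  leaf_ne : ∀ i < m, y i ≠ c (a i) ∧ y i ≠ c (b i)
  spine_ne_leaf : ∀ i < m, z (i + 1) ≠ y i
  spine_ne_spine : ∀ i < m, z (i + 1) ≠ z i

variable {c a b : ℕ → ℕ} {Z Y : ℕ → Finset ℕ} {m : ℕ}

theorem IsPrefixColoring.succ {z y : ℕ → ℕ} (h : IsPrefixColoring c a b Z Y m z y) {u v : ℕ}
    (hv : v ∈ Z (m + 1)) (hu : u ∈ Y m) (hua : u ≠ c (a m)) (hub : u ≠ c (b m)) (hvu : v ≠ u)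
    (hvz : v ≠ z m) :
    IsPrefixColoring c a b Z Y (m + 1) (Function.update z (m + 1) v) (Function.update y m u) := by
  obtain ⟨h1, h2, h3, h4, h5, h6⟩ := h
  constructor <;> grind [Function.update_apply]

theorem exists_isPrefixColoring (hZ : ∀ i, 3 ≤ (Z i).card) (hY : ∀ i, 3 ≤ (Y i).card) (m : ℕ) :
    ∃ z y, IsPrefixColoring c a b Z Y m z y := by
  induction m with
  | zero =>
    obtain ⟨v, hv, h0, h1⟩ := exists_mem_ne_ne (hZ 0) (c 0) (c 1)
    exact ⟨fun _ => v, fun _ => 0, by constructor <;> simp [*]⟩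
  | succ m ih =>
    obtain ⟨z, y, h⟩ := ih
    obtain ⟨u, hu, hua, hub⟩ := exists_mem_ne_ne (hY m) (c (a m)) (c (b m))
    obtain ⟨v, hv, hvu, hvz⟩ := exists_mem_ne_ne (hZ (m + 1)) u (z m)
    exact ⟨_, _, h.succ hv hu hua hub hvu hvz⟩

theorem exists_isPrefixColoring_ne (hZ : ∀ i, 3 ≤ (Z i).card) (hY : ∀ i, 3 ≤ (Y i).card)
    (hc : c 0 = c 1 ∨ ∃ i < m, c (a i) = c (b i)) (f : ℕ) :
    ∃ z y, IsPrefixColoring c a b Z Y m z y ∧ z m ≠ f := by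
  induction m generalizing f with
  | zero =>
    obtain ⟨v, hv, h0, h1⟩ := exists_mem_ne_ne (hZ 0) (c 0) f
    exact ⟨fun _ => v, fun _ => 0, by constructor <;> simp_all, h1⟩
  | succ m ih =>
    by_cases hm : c (a m) = c (b m)
    · obtain ⟨z, y, h⟩ := exists_isPrefixColoring (c := c) (a := a) (b := b) hZ hY m
      obtain ⟨v, hv, hvz, hvf⟩ := exists_mem_ne_ne (hZ (m + 1)) (z m) f
      obtain ⟨u, hu, hua, huv⟩ := exists_mem_ne_ne (hY m) (c (a m)) v
      exact ⟨_, _, h.succ hv hu hua (hm ▸ hua) huv.symm hvz, by simpa⟩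
    · obtain ⟨u, hu, hua, hub⟩ := exists_mem_ne_ne (hY m) (c (a m)) (c (b m))
      obtain ⟨v, hv, hvu, hvf⟩ := exists_mem_ne_ne (hZ (m + 1)) u f
      obtain ⟨z, y, h, hz⟩ := ih (hc.imp_right fun ⟨i, hi, hi'⟩ =>
        ⟨i, lt_of_le_of_ne (Nat.le_of_lt_succ hi) (by rintro rfl; exact hm hi'), hi'⟩) v
      exact ⟨_, _, h.succ hv hu hua hub hvu hz.symm, by simpa⟩

/-- The terminals of the vertices of a caterpillar with pendant vertices. -/
def caterpillarAtt (a b : ℕ → ℕ) {d n : ℕ} : (Fin (n + 1) × Bool) × Option (Fin d) → Set ℕ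
  | ((i, false), _) => {a i, b i}
  | ((_, true), some _) => {0, 1}
  | ((i, true), none) => {j | (i : ℕ) = 0 ∧ (j = 0 ∨ j = 1)}

/-- The lists to which no rainbow coloring of the terminals extends: the spine vertex `i` is forced
to take the color `f i` and the leaf `i` to take the color `g i`. -/
def caterpillarList (c a b f g : ℕ → ℕ) {d n : ℕ} :
    (Fin (n + 1) × Bool) × Option (Fin d) → Finset ℕ
  | ((i, false), _) => {c (a i), c (b i), g i}
  | ((i, true), some _) => {c 0, c 1, f i}
  | ((i, true), none) => if (i : ℕ) = 0 then {c 0, c 1, f i} else {f (i - 1), g (i - 1), f i}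

theorem not_isExtension_caterpillarList {d n : ℕ} {f g : ℕ → ℕ} (hgn : g n = f n)
    (φ : (Fin (n + 1) × Bool) × Option (Fin d) → ℕ) :
    ¬ IsExtension (pendantGraph (caterpillar n) d) (caterpillarAtt a b) d c
      (caterpillarList c a b f g) φ := by
  rintro ⟨hL, hc, hd⟩
  have leaf (i : Fin (n + 1)) (s) : φ ((i, false), s) = g i := by
    have h1 := hL ((i, false), s)
    have h2 := hc ((i, false), s)
    simp_all [caterpillarList, caterpillarAtt]
  have pend (i : Fin (n + 1)) (s) : φ ((i, true), some s) = f i := by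
    have h1 := hL ((i, true), some s)
    have h2 := hc ((i, true), some s)
    simp_all [caterpillarList, caterpillarAtt]
  have spine (i : ℕ) (hi : i < n + 1) : φ ((⟨i, hi⟩, true), none) = f i := by
    induction i with
    | zero =>
      have h1 := hL ((⟨0, hi⟩, true), none)
      have h2 := hc ((⟨0, hi⟩, true), none)
      simp_all [caterpillarList, caterpillarAtt]
    | succ i ih =>
      have hi' : i < n + 1 := by omega
      have h1 := hL ((⟨i + 1, hi⟩, true), none)
      have h2 : φ ((⟨i + 1, hi⟩, true), none) ≠ φ ((⟨i, hi'⟩, true), none) :=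
        ne_of_pendants_eq (hd _) (fun s => by rw [pend, ih hi']) (by simp [caterpillar])
      have h3 : φ ((⟨i + 1, hi⟩, true), none) ≠ φ ((⟨i, hi'⟩, false), none) :=
        ne_of_pendants_eq (hd _) (fun s => by rw [leaf, leaf])
          (by simp [caterpillar]; omega)
      rw [ih] at h2
      rw [leaf] at h3
      simp_all [caterpillarList]
  refine ne_of_pendants_eq (v := (⟨n, by omega⟩, true)) (w := (⟨n, by omega⟩, false)) (hd _)
    (fun s => by rw [pend, spine]) (by simp [caterpillar]) ?_
  rw [leaf, spine, hgn]

theorem testsRainbow_caterpillar {d n t : ℕ} (ht : 2 ≤ t) (han : a n = 0) (hbn : b n = 1)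
    (hab : ∀ i < n, a i < b i ∧ 2 ≤ b i ∧ b i < t)
    (hcover : ∀ x y, x < y → 2 ≤ y → y < t → ∃ i < n, a i = x ∧ b i = y) :
    TestsRainbow (pendantGraph (caterpillar n) d) (caterpillarAtt a b) d t t where
  lt_of_mem := by
    rintro ⟨⟨i, _ | _⟩, _ | s⟩ j hj
    all_goals
      have := hab i
      have hi := i.2
      rcases eq_or_ne (i : ℕ) n with hin | hin
      all_goals simp [caterpillarAtt] at hj; grind
  exists_isExtension := by
    intro P _ c _ hinj L hk _
    have hc : c 0 = c 1 ∨ ∃ i < n, c (a i) = c (b i) := by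
      by_contra! hne
      have hne' (x y) (hxy : x < y) (hy : y < t) : c x ≠ c y := by
        by_cases h2 : 2 ≤ y
        · obtain ⟨i, hi, rfl, rfl⟩ := hcover x y hxy h2 hy
          exact hne.2 i hi
        · obtain ⟨rfl, rfl⟩ : x = 0 ∧ y = 1 := by omega
          exact hne.1
      refine hinj rfl fun x hx y hy hxy => ?_
      rcases lt_trichotomy x y with h | h | h
      · exact absurd hxy (hne' x y h hy)
      · exact h
      · exact absurd hxy.symm (hne' y x h hx)
    obtain ⟨u, hu, hu0, hu1⟩ := exists_mem_ne_ne (hk ((⟨n, by omega⟩, false), none)) (c 0) (c 1)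
    obtain ⟨z, y, h, hzn⟩ := exists_isPrefixColoring_ne
      (Z := fun i => L ((⟨min i n, by omega⟩, true), none))
      (Y := fun i => L ((⟨min i n, by omega⟩, false), none)) (fun i => hk _) (fun i => hk _) hc u
    choose p hp hp0 hp1 using fun x => exists_mem_ne_ne (hk x) (c 0) (c 1)
    choose q hq hqa hqb using fun x => exists_mem_ne_ne (hk x) (c (a x.1.1)) (c (b x.1.1))
    have hmin (i : Fin (n + 1)) : (⟨min i n, by omega⟩ : Fin (n + 1)) = i := by
      ext
      exact min_eq_left (by omega)
    have hz (i : Fin (n + 1)) : z i ∈ L ((i, true), none) := by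
      simpa only [hmin] using h.spine_mem i (by omega)
    have hy (i : Fin (n + 1)) : Function.update y n u i ∈ L ((i, false), none) ∧
        Function.update y n u i ≠ c (a i) ∧ Function.update y n u i ≠ c (b i) := by
      rcases eq_or_ne (i : ℕ) n with hin | hin
      · have hi : i = ⟨n, by omega⟩ := Fin.ext hin
        rw [hi]
        simpa [han, hbn] using ⟨hu, hu0, hu1⟩
      · have hlt : (i : ℕ) < n := by omega
        rw [Function.update_of_ne hin]
        exact ⟨by simpa only [hmin] using h.leaf_mem i hlt, h.leaf_ne i hlt⟩
    refine ⟨fun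
      | ((i, true), none) => z i
      | ((i, false), none) => Function.update y n u i
      | ((i, true), some s) => p ((i, true), some s)
      | ((i, false), some s) => q ((i, false), some s), ?_, ?_, defect_pendantGraph_le ?_⟩
    · rintro ⟨⟨i, _ | _⟩, _ | s⟩
      · exact (hy i).1
      · exact hq _
      · exact hz i
      · exact hp _
    · rintro ⟨⟨i, _ | _⟩, _ | s⟩ j hj
      · rcases hj with rfl | rfl
        exacts [(hy i).2.1, (hy i).2.2]
      · rcases hj with rfl | rfl
        exacts [hqa _, hqb _]
      · obtain ⟨hi, rfl | rfl⟩ := hj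
        · simpa only [hi] using h.spine_zero.1
        · simpa only [hi] using h.spine_zero.2
      · rcases hj with rfl | rfl
        exacts [hp0 _, hp1 _]
    · have h5 := h.spine_ne_leaf
      have h6 := h.spine_ne_spine
      rintro ⟨⟨i, hi⟩, _ | _⟩ ⟨⟨j, hj⟩, _ | _⟩ hadj <;>
        simp [caterpillar, Function.update_apply] at hadj ⊢ <;> grind
  exists_bad := by
    intro P hP c hc hinj
    have hcard : (P \ (range t).image c).card = 2 := by
      rw [card_sdiff_of_subset (image_subset_iff.2 fun i hi => hc i (mem_range.1 hi)),
        card_image_of_injOn (by simpa using hinj), card_range]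
      omega
    obtain ⟨α, β, hαβ, hP'⟩ := card_eq_two.1 hcard
    have hmem (x) : x ∈ P ∧ (∀ i < t, c i ≠ x) ↔ x = α ∨ x = β := by
      have := Finset.ext_iff.1 hP' x
      simpa using this
    obtain ⟨hα, hα'⟩ := (hmem α).2 (Or.inl rfl)
    obtain ⟨hβ, hβ'⟩ := (hmem β).2 (Or.inr rfl)
    let f (i : ℕ) : ℕ := if Even i then α else β
    let g (i : ℕ) : ℕ := if i < n then c (if a i = 0 then 1 else 0) else f n
    have hf (i) : f i ∈ P ∧ ∀ j < t, c j ≠ f i := by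
      by_cases hi : Even i <;> simp only [f, hi, if_true, if_false] <;> exact ⟨‹_›, ‹_›⟩
    have hff (i) : f i ≠ f (i + 1) := by
      by_cases hi : Even i <;> simp [f, hi, Nat.even_add_one, hαβ, hαβ.symm]
    have hinj' (i j) (hi : i < t) (hj : j < t) (hij : i ≠ j) : c i ≠ c j :=
      fun h => hij (hinj hi hj h)
    have h01 (i) : #{c 0, c 1, f i} = 3 ∧ {c 0, c 1, f i} ⊆ P := by
      exact card_triple_and_subset (hinj' _ _ (by omega) (by omega) (by omega))
        ((hf i).2 _ (by omega)) ((hf i).2 _ (by omega)) (hc _ (by omega)) (hc _ (by omega)) (hf i).1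
    have hag (i) (hi : i < n + 1) : #{c (a i), c (b i), g i} = 3 ∧ {c (a i), c (b i), g i} ⊆ P := by
      by_cases hin : i < n
      · obtain ⟨h1, h2, h3⟩ := hab i hin
        have hg : g i = c (if a i = 0 then 1 else 0) := if_pos hin
        rw [hg]
        apply card_triple_and_subset <;> first | apply hinj' | apply hc
        all_goals grind
      · obtain rfl : i = n := by omega
        have hg : g i = f i := if_neg hin
        rw [hg, han, hbn]
        exact h01 i
    have hfg (i) (hi : i < n) : #{f i, g i, f (i + 1)} = 3 ∧ {f i, g i, f (i + 1)} ⊆ P := by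
      have hg : g i = c (if a i = 0 then 1 else 0) := if_pos hi
      have hlt : (if a i = 0 then 1 else 0) < t := by split_ifs <;> omega
      rw [hg]
      exact card_triple_and_subset ((hf _).2 _ hlt).symm (hff i) ((hf _).2 _ hlt) (hf _).1
        (hc _ hlt) (hf _).1
    have key : ∀ v, #(caterpillarList c a b f g (d := d) (n := n) v) = 3 ∧
        caterpillarList c a b f g (d := d) (n := n) v ⊆ P := by
      rintro ⟨⟨⟨_ | i, hi⟩, _ | _⟩, _ | s⟩
      · exact hag _ hi
      · exact hag _ hi
      · exact h01 _
      · exact h01 _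
      · exact hag _ hi
      · exact hag _ hi
      · exact hfg i (by omega)
      · exact h01 _
    exact ⟨_, fun v => (key v).1.ge, fun v => (key v).2,
      fun ⟨φ, hφ⟩ => not_isExtension_caterpillarList (by simp [g]) φ hφ⟩

end Caterpillar

theorem exists_testsRainbow (d t j : ℕ) (ht : 2 ≤ t) (hj : j ≤ t) :
    ∃ (V : Type) (_ : Fintype V) (G : SimpleGraph V) (att : V → Set ℕ),
      TestsRainbow G att d t j := by
  induction hj using Nat.decreasingInduction with
  | self =>
    let S := (range t ×ˢ range t).filter fun p => p.1 < p.2 ∧ 2 ≤ p.2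
    have hS (p) : p ∈ S ↔ p.1 < p.2 ∧ 2 ≤ p.2 ∧ p.2 < t := by
      simp only [S, mem_filter, mem_product, mem_range]
      omega
    let s (i : ℕ) : ℕ × ℕ := S.toList.getD i (0, 1)
    refine ⟨_, inferInstance, _, _, testsRainbow_caterpillar (n := S.toList.length)
      (a := fun i => (s i).1) (b := fun i => (s i).2) ht ?_ ?_ ?_ ?_⟩
    · simp [s]
    · simp [s]
    · intro i hi
      refine (hS _).1 (mem_toList.1 ?_)
      simp only [s, List.getD_eq_getElem _ _ hi]
      exact List.getElem_mem hi
    · intro x y hxy hy hyt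
      obtain ⟨i, hi, h⟩ := List.getElem_of_mem (mem_toList.2 ((hS (x, y)).2 ⟨hxy, hy, hyt⟩))
      refine ⟨i, hi, ?_⟩
      simp only [s, List.getD_eq_getElem _ _ hi, h, and_self]
  | of_succ j hj ih =>
    obtain ⟨V, _, G, att, h⟩ := ih
    exact ⟨_, inferInstance, _, _, h.cone hj⟩

theorem exists_separates (k d ℓ : ℕ) (hk : 3 ≤ k) (hℓ : k ≤ ℓ) :
    ∃ (V : Type) (_ : Fintype V) (G : SimpleGraph V), Separates G k d ℓ := by
  induction k, hk using Nat.le_induction generalizing ℓ with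
  | base =>
    obtain ⟨V, hV, G, att, h⟩ := exists_testsRainbow d (ℓ - 1) 0 (by omega) (by omega)
    have h' := h.separates (by omega)
    rw [Nat.sub_add_cancel (by omega)] at h'
    exact ⟨V, hV, G, h'⟩
  | succ k hk ih =>
    obtain ⟨ℓ, rfl⟩ := Nat.exists_eq_add_of_le' (show 1 ≤ ℓ by omega)
    obtain ⟨V, _, G, h⟩ := ih ℓ (by omega)
    exact ⟨_, inferInstance, _, h.cone (by omega)⟩

/-- For all integers `d ≥ 0` and `ℓ ≥ k ≥ 3`, there is a finite simple graph that is
`(k,d,ℓ)`-choosable but not `(k,d,ℓ+1)`-choosable. -/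
theorem statement0 (k d ℓ : ℕ) (hk : 3 ≤ k) (hℓ : k ≤ ℓ) :
    ∃ (V : Type) (_ : Fintype V) (G : SimpleGraph V),
      Choosable G k d ℓ ∧ ¬ Choosable G k d (ℓ + 1) := by
  obtain ⟨V, hV, G, h⟩ := exists_separates k d ℓ hk hℓ
  exact ⟨V, hV, G, h.choosable⟩
end

section
/- Let k ≥ 1 and d ≥ 0 be integers. Every finite simple graph G with Δ(G) + 1 ≤ k(d+1) is d-defective k-choosable, where Δ(G) denotes the maximum degree of G. -/
open Classical in
/-- The number of neighbors of `v` that receive the color `c` under `φ`. -/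
noncomputable def neighborCount {V : Type*} [Fintype V] (G : SimpleGraph V) (φ : V → ℕ)
    (v : V) (c : ℕ) : ℕ :=
  ∑ w, if G.Adj v w ∧ φ w = c then 1 else 0

lemma neighborCount_eq_card {V : Type*} [Fintype V] (G : SimpleGraph V) [DecidableRel G.Adj]
    (φ : V → ℕ) (v : V) (c : ℕ) :
    neighborCount G φ v c = {w ∈ G.neighborFinset v | φ w = c}.card := by
  classical
  rw [neighborCount, Finset.card_filter, G.neighborFinset_eq_filter, Finset.sum_filter]
  refine Finset.sum_congr rfl fun w _ ↦ ?_
  rw [ite_and]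
  congr

lemma defect_eq_neighborCount {V : Type*} [Fintype V] (G : SimpleGraph V) (φ : V → ℕ) (v : V) :
    defect G φ v = neighborCount G φ v (φ v) := by
  classical
  simp only [defect, neighborCount, Finset.sum_boole, Nat.cast_id]
  rw [← Set.ncard_coe_finset]
  simp

open Classical in
/-- Isolating `v` in the total defect: the edges at `v` count twice, the others do not involve
the color of `v`. -/
lemma sum_defect_eq {V : Type*} [Fintype V] (G : SimpleGraph V) (φ : V → ℕ) (v : V) :
    ∑ u, defect G φ u = 2 * defect G φ v +
      ∑ u ∈ {v}ᶜ, ∑ w ∈ {v}ᶜ, if G.Adj u w ∧ φ w = φ u then 1 else 0 := by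
  have hv : defect G φ v = ∑ u ∈ {v}ᶜ, if G.Adj u v ∧ φ v = φ u then 1 else 0 := by
    rw [defect_eq_neighborCount, neighborCount, Fintype.sum_eq_add_sum_compl v]
    simp [G.adj_comm v, eq_comm]
  rw [Fintype.sum_eq_add_sum_compl v, two_mul, add_assoc]
  congr 1
  rw [hv]
  rw [← Finset.sum_add_distrib]
  refine Finset.sum_congr rfl fun u _ ↦ ?_
  rw [defect_eq_neighborCount, neighborCount, Fintype.sum_eq_add_sum_compl v]

open Classical in
lemma defect_update_self {V : Type*} [Fintype V] (G : SimpleGraph V) (φ : V → ℕ) (v : V) (c : ℕ) :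
    defect G (Function.update φ v c) v = neighborCount G φ v c := by
  rw [defect_eq_neighborCount, neighborCount, neighborCount]
  refine Finset.sum_congr rfl fun w _ ↦ ?_
  by_cases h : w = v
  · simp [h]
  · simp [h]

open Classical in
/-- Recoloring `v` with a color that is rarer among its neighbors lowers the total defect. -/
lemma sum_defect_update_lt {V : Type*} [Fintype V] (G : SimpleGraph V) (φ : V → ℕ) (v : V) (c : ℕ)
    (h : neighborCount G φ v c < defect G φ v) :
    ∑ u, defect G (Function.update φ v c) u < ∑ u, defect G φ u := by
  rw [sum_defect_eq G _ v, sum_defect_eq G φ v, defect_update_self]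
  have hrest : ∑ u ∈ {v}ᶜ, ∑ w ∈ {v}ᶜ, (if G.Adj u w ∧
        Function.update φ v c w = Function.update φ v c u then 1 else 0) =
      ∑ u ∈ {v}ᶜ, ∑ w ∈ {v}ᶜ, if G.Adj u w ∧ φ w = φ u then 1 else 0 := by
    refine Finset.sum_congr rfl fun u hu ↦ Finset.sum_congr rfl fun w hw ↦ ?_
    rw [Finset.mem_compl, Finset.mem_singleton] at hu hw
    simp [hu, hw]
  omega

lemma sum_neighborCount_le_degree {V : Type*} [Fintype V] (G : SimpleGraph V) [DecidableRel G.Adj]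
    (φ : V → ℕ) (v : V) (s : Finset ℕ) :
    ∑ c ∈ s, neighborCount G φ v c ≤ G.degree v := by
  simp_rw [neighborCount_eq_card]
  rw [Finset.sum_card_fiberwise_eq_card_filter]
  exact Finset.card_filter_le _ _

/-- Every finite simple graph `G` with `Δ(G) + 1 ≤ k(d+1)` is `d`-defective `k`-choosable. -/
theorem statement6 {V : Type*} [Fintype V] (G : SimpleGraph V) [DecidableRel G.Adj]
    (k d : ℕ) (hk : 1 ≤ k) (hΔ : G.maxDegree + 1 ≤ k * (d + 1)) :
    ∀ L : V → Finset ℕ, (∀ v, k ≤ (L v).card) →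
      ∃ φ : V → ℕ, (∀ v, φ v ∈ L v) ∧ ∀ v, defect G φ v ≤ d := by
  classical
  intro L hL
  have hne : (Fintype.piFinset L).Nonempty :=
    Fintype.piFinset_nonempty.2 fun v ↦ Finset.card_pos.1 (hk.trans (hL v))
  obtain ⟨φ, hφ, hmin⟩ := Finset.exists_min_image _ (fun φ ↦ ∑ u, defect G φ u) hne
  rw [Fintype.mem_piFinset] at hφ
  refine ⟨φ, hφ, fun v ↦ ?_⟩
  by_contra! hv
  obtain ⟨c, hc, hcd⟩ : ∃ c ∈ L v, neighborCount G φ v c < d + 1 := by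
    by_contra! hlarge
    have hcard := Finset.card_nsmul_le_sum _ (fun c ↦ neighborCount G φ v c) _ hlarge
    have hdeg := sum_neighborCount_le_degree G φ v (L v)
    have hmul := Nat.mul_le_mul_right (d + 1) (hL v)
    have hmax := G.degree_le_maxDegree v
    rw [smul_eq_mul] at hcard
    omega
  refine (sum_defect_update_lt G φ v c (by omega)).not_ge (hmin _ ?_)
  rw [Fintype.mem_piFinset]
  intro u
  by_cases h : u = v
  · subst h
    simpa using hc
  · simpa [h] using hφ u
end

section
/- Let k ≥ 1 and d ≥ 0 be integers, let G be a complete graph on k(d+1) vertices, and let v be any vertex of G. If L is a list assignment of G with |L(u)| ≥ k for every u ∈ V(G) \ {v} and |L(v)| = 1, then G has a d-defective L-coloring. -/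
/-- If all color classes of `φ` are injectively labelled by `Fin (d + 1)`, then `φ` has defect at
most `d` everywhere. -/
theorem defect_le_of_injective_prod {V : Type*} (G : SimpleGraph V) {d : ℕ}
    {f : V → ℕ × Fin (d + 1)} (hf : Function.Injective f) (u : V) :
    defect G (fun w => (f w).1) u ≤ d := by
  have hmaps : ∀ w ∈ {w | G.Adj u w ∧ (f w).1 = (f u).1},
      (f w).2 ∈ ((Finset.univ.erase (f u).2 : Finset (Fin (d + 1))) : Set (Fin (d + 1))) := by
    rintro w ⟨hadj, hcol⟩
    simp only [Finset.coe_erase, Finset.coe_univ, Set.mem_sdiff, Set.mem_univ, true_and,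
      Set.mem_singleton_iff]
    exact fun h => hadj.ne (hf (Prod.ext hcol h)).symm
  have hinj : Set.InjOn (fun w => (f w).2) {w | G.Adj u w ∧ (f w).1 = (f u).1} :=
    fun a ha b hb h => hf (Prod.ext (ha.2.trans hb.2.symm) h)
  have hcard := Set.ncard_le_ncard_of_injOn _ hmaps hinj (Finset.finite_toSet _)
  rw [Set.ncard_coe_finset, Finset.card_erase_of_mem (Finset.mem_univ _), Finset.card_univ,
    Fintype.card_fin] at hcard
  exact hcard

/-- Let `G` be the complete graph on `k(d+1)` vertices, `v` a vertex of `G`, and `L` a list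
assignment with `|L(u)| ≥ k` for `u ≠ v` and `|L(v)| = 1`.  Then `G` has a `d`-defective
`L`-coloring. -/
theorem statement7 (k d : ℕ) (hk : 1 ≤ k) (v : Fin (k * (d + 1)))
    (L : Fin (k * (d + 1)) → Finset ℕ)
    (hL : ∀ u, u ≠ v → k ≤ (L u).card) (hv : (L v).card = 1) :
    ∃ φ : Fin (k * (d + 1)) → ℕ, (∀ u, φ u ∈ L u) ∧
      ∀ u, defect (⊤ : SimpleGraph (Fin (k * (d + 1)))) φ u ≤ d := by
  have hall : ∀ s : Finset (Fin (k * (d + 1))),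
      s.card ≤ (s.biUnion fun u => L u ×ˢ (Finset.univ : Finset (Fin (d + 1)))).card := by
    intro s
    by_cases hs : ∃ u ∈ s, u ≠ v
    · obtain ⟨u, hus, huv⟩ := hs
      calc s.card ≤ k * (d + 1) := by simpa using Finset.card_le_univ s
        _ ≤ (L u).card * (d + 1) := Nat.mul_le_mul_right _ (hL u huv)
        _ = (L u ×ˢ (Finset.univ : Finset (Fin (d + 1)))).card := by simp
        _ ≤ _ := Finset.card_le_card
          (Finset.subset_biUnion_of_mem (fun u => L u ×ˢ Finset.univ) hus)
    · push Not at hs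
      rcases Finset.subset_singleton_iff.mp
        (fun u hu => Finset.mem_singleton.mpr (hs u hu)) with rfl | rfl
      · simp
      · simp [hv]
  obtain ⟨f, hf, hfL⟩ := (Finset.all_card_le_biUnion_card_iff_exists_injective _).mp hall
  exact ⟨fun u => (f u).1, fun u => (Finset.mem_product.mp (hfL u)).1,
    defect_le_of_injective_prod _ hf⟩
end

section
/- Let k ≥ 1 and d ≥ 0 be integers, let G be a finite simple graph, and let L be a list assignment of G with |L(v)| ≥ k for every vertex v. Let (A,B) be a partition of V(G) such that the induced subgraph G[A] has a d-defective coloring from the lists L restricted to A. If for every vertex v ∈ B one has (d+1)·|N_G(v) ∩ A| + deg_B(v) + 1 ≤ (d+1)·k, where deg_B(v) is the number of neighbors of v in B, then G has a d-defective L-coloring. -/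
/-- The spanning subgraph of edges whose endpoints receive the same color. -/
def monochromaticSubgraph {V : Type*} (G : SimpleGraph V) (φ : V → ℕ) : SimpleGraph V where
  Adj v w := G.Adj v w ∧ φ w = φ v
  symm := ⟨fun _ _ h => ⟨h.1.symm, h.2.symm⟩⟩
  loopless := ⟨fun v h => G.loopless.irrefl v h.1⟩

open Classical in
theorem degree_monochromaticSubgraph {V : Type*} [Fintype V] (G : SimpleGraph V)
    (φ : V → ℕ) (v : V) : (monochromaticSubgraph G φ).degree v = defect G φ v := by
  rw [← SimpleGraph.card_neighborFinset_eq_degree, defect, Set.ncard_eq_toFinset_card']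
  congr 1
  ext w
  rw [SimpleGraph.mem_neighborFinset]
  simp [monochromaticSubgraph]

open Classical in
/-- Recoloring a single vertex so that its defect drops decreases the number of monochromatic
edges. -/
theorem card_edgeFinset_monochromaticSubgraph_update_lt {V : Type*} [Fintype V]
    (G : SimpleGraph V) (φ : V → ℕ) (v : V) (c : ℕ)
    (h : defect G (Function.update φ v c) v < defect G φ v) :
    (monochromaticSubgraph G (Function.update φ v c)).edgeFinset.card <
      (monochromaticSubgraph G φ).edgeFinset.card := by
  have hdel : (monochromaticSubgraph G (Function.update φ v c)).deleteIncidenceSet v =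
      (monochromaticSubgraph G φ).deleteIncidenceSet v := by
    ext x y
    simp only [SimpleGraph.deleteIncidenceSet_adj, monochromaticSubgraph]
    constructor <;> rintro ⟨h₁, hx, hy⟩ <;> simp_all [Function.update_of_ne]
  have h₁ := (monochromaticSubgraph G φ).card_edgeFinset_deleteIncidenceSet v
  have h₂ :=
    (monochromaticSubgraph G (Function.update φ v c)).card_edgeFinset_deleteIncidenceSet v
  have h₃ := (monochromaticSubgraph G φ).degree_le_card_edgeFinset v
  have h₄ :=
    (monochromaticSubgraph G (Function.update φ v c)).degree_le_card_edgeFinset v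
  have hcard : ((monochromaticSubgraph G (Function.update φ v c)).deleteIncidenceSet
      v).edgeFinset.card = ((monochromaticSubgraph G φ).deleteIncidenceSet v).edgeFinset.card := by
    congr!
  rw [degree_monochromaticSubgraph] at h₁ h₂ h₃ h₄
  omega

open Classical in
/-- Lovász's defective coloring lemma, for lists. -/
theorem exists_defective_list_coloring {V : Type*} [Fintype V] (G : SimpleGraph V) (d : ℕ)
    (L : V → Finset ℕ) (hL : ∀ v, G.degree v < (L v).card * (d + 1)) :
    ∃ φ : V → ℕ, (∀ v, φ v ∈ L v) ∧ ∀ v, defect G φ v ≤ d := by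
  have hne : (Fintype.piFinset L).Nonempty := by
    refine Fintype.piFinset_nonempty.2 fun v => Finset.card_pos.1 ?_
    exact pos_of_mul_pos_left ((Nat.zero_le _).trans_lt (hL v)) (Nat.zero_le _)
  obtain ⟨φ, hφ, hmin⟩ := Finset.exists_min_image (Fintype.piFinset L)
    (fun φ => (monochromaticSubgraph G φ).edgeFinset.card) hne
  rw [Fintype.mem_piFinset] at hφ
  refine ⟨φ, hφ, fun v => ?_⟩
  by_contra! hv
  obtain ⟨c, hc, hcard⟩ := Finset.exists_card_fiber_lt_of_card_lt_mul (f := φ)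
    (s := G.neighborFinset v) (t := L v) (n := d + 1)
    (by simpa using hL v)
  have hdefect : defect G (Function.update φ v c) v < d + 1 := by
    convert hcard using 1
    rw [defect, Set.ncard_eq_toFinset_card']
    congr 1
    ext w
    simp only [Set.mem_toFinset, Set.mem_ofPred_eq, Finset.mem_filter,
      SimpleGraph.mem_neighborFinset, Function.update_self]
    refine and_congr_right fun hw => ?_
    rw [Function.update_of_ne hw.ne']
  refine (hmin (Function.update φ v c) ?_).not_gt
    (card_edgeFinset_monochromaticSubgraph_update_lt G φ v c (by omega))
  rw [Fintype.mem_piFinset]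
  intro w
  rcases eq_or_ne w v with rfl | hw
  · simpa using hc
  · simpa [hw] using hφ w

/-- Let `L` be a `k`-list assignment of `G` and `(A,B)` a partition of `V(G)` such that the
induced subgraph `G[A]` has a `d`-defective coloring from the lists.  If every `v ∈ B`
satisfies `(d+1)|N_G(v) ∩ A| + deg_B(v) + 1 ≤ (d+1)k`, then `G` has a `d`-defective
`L`-coloring. -/
theorem statement8 {V : Type*} [Fintype V] (G : SimpleGraph V) (k d : ℕ) (hk : 1 ≤ k)
    (L : V → Finset ℕ) (hL : ∀ v, k ≤ (L v).card)
    (A B : Set V) (hunion : A ∪ B = Set.univ) (hdisj : A ∩ B = ∅)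
    (hA : ∃ φ₀ : V → ℕ, (∀ v ∈ A, φ₀ v ∈ L v) ∧
      ∀ v ∈ A, {w | w ∈ A ∧ G.Adj v w ∧ φ₀ w = φ₀ v}.ncard ≤ d)
    (hB : ∀ v ∈ B, (d + 1) * {w | w ∈ A ∧ G.Adj v w}.ncard
        + {w | w ∈ B ∧ G.Adj v w}.ncard + 1 ≤ (d + 1) * k) :
    ∃ φ : V → ℕ, (∀ v, φ v ∈ L v) ∧ ∀ v, defect G φ v ≤ d := by
  classical
  obtain ⟨φ₀, hφ₀L, hφ₀⟩ := hA
  have hAB : ∀ v, v ∉ A → v ∈ B := fun v hv =>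
    (show v ∈ A ∪ B by rw [hunion]; trivial).resolve_left hv
  have hBA : ∀ v, v ∈ B → v ∉ A := fun v hv hvA =>
    (show v ∉ A ∩ B by rw [hdisj]; exact id) ⟨hvA, hv⟩
  obtain ⟨H, hH⟩ : ∃ H : SimpleGraph V, ∀ v w, H.Adj v w ↔ v ∈ B ∧ w ∈ B ∧ G.Adj v w :=
    ⟨{ Adj := fun v w => v ∈ B ∧ w ∈ B ∧ G.Adj v w
       symm := ⟨fun _ _ h => ⟨h.2.1, h.1, h.2.2.symm⟩⟩
       loopless := ⟨fun v h => G.loopless.irrefl v h.2.2⟩ }, fun _ _ => Iff.rfl⟩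
  let N : V → Finset V := fun v => {w | w ∈ A ∧ G.Adj v w}
  let M : V → Finset ℕ := fun v => if v ∈ A then {φ₀ v} else L v \ (N v).image φ₀
  have hM : ∀ v, H.degree v < (M v).card * (d + 1) := by
    intro v
    by_cases hv : v ∈ A
    · have hdeg : H.degree v = 0 := by
        rw [← SimpleGraph.card_neighborFinset_eq_degree, Finset.card_eq_zero]
        ext w
        simpa [hH] using fun hvB => absurd hv (hBA v hvB)
      simp [M, hv, hdeg]
    · have hvB := hAB v hv
      have hdeg : H.degree v = {w | w ∈ B ∧ G.Adj v w}.ncard := by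
        rw [← SimpleGraph.card_neighborFinset_eq_degree, Set.ncard_eq_toFinset_card']
        congr 1
        ext w
        simp [hH, hvB]
      have hN : {w | w ∈ A ∧ G.Adj v w}.ncard = (N v).card := by
        rw [Set.ncard_eq_toFinset_card']
        congr 1
        ext w
        simp [N]
      have hcard : k ≤ (M v).card + (N v).card := by
        have h₁ := Finset.le_card_sdiff ((N v).image φ₀) (L v)
        have h₂ := Finset.card_image_le (s := N v) (f := φ₀)
        have h₃ := hL v
        simp only [M, if_neg hv]
        omega
      have h := hB v hvB
      rw [hN, ← hdeg] at h
      nlinarith [Nat.mul_le_mul_left (d + 1) hcard]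
  obtain ⟨φ, hφM, hφ⟩ := exists_defective_list_coloring H d M hM
  have hφA : ∀ v ∈ A, φ v = φ₀ v := fun v hv => by simpa [M, hv] using hφM v
  have hφB : ∀ v ∈ B, φ v ∈ L v ∧ ∀ w ∈ A, G.Adj v w → φ w ≠ φ v := by
    intro v hv
    have h := hφM v
    simp only [M, if_neg (hBA v hv), Finset.mem_sdiff, Finset.mem_image, not_exists] at h
    refine ⟨h.1, fun w hw hvw heq => h.2 w ⟨?_, (hφA w hw).symm.trans heq⟩⟩
    simpa [N] using ⟨hw, hvw⟩
  refine ⟨φ, fun v => ?_, fun v => ?_⟩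
  · by_cases hv : v ∈ A
    · rw [hφA v hv]
      exact hφ₀L v hv
    · exact (hφB v (hAB v hv)).1
  · by_cases hv : v ∈ A
    · refine (Set.ncard_le_ncard ?_ (Set.toFinite _)).trans (hφ₀ v hv)
      rintro w ⟨hvw, heq⟩
      have hw : w ∈ A := by
        by_contra hw
        exact (hφB w (hAB w hw)).2 v hv hvw.symm heq.symm
      exact ⟨hw, hvw, by rw [← hφA w hw, ← hφA v hv, heq]⟩
    · refine (Set.ncard_le_ncard ?_ (Set.toFinite _)).trans (hφ v)
      rintro w ⟨hvw, heq⟩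
      have hw : w ∉ A := fun hw => (hφB v (hAB v hv)).2 w hw hvw heq
      exact ⟨(hH v w).2 ⟨hAB v hv, hAB w hw, hvw⟩, heq⟩
end

section
/- Let k ≥ 3, t ≥ 2, d ≥ 0 be integers and set ℓ = k − 2 + t. There exists a finite simple graph H with an independent set T = {u₁, …, u_t} of t vertices such that all of the following hold. (i) For every precoloring φ of T that uses t distinct colors from {1, …, ℓ+1}, there is a list assignment L of H with |L(w)| ≥ k and L(w) ⊆ {1, …, ℓ+1} for every vertex w ∈ V(H) \ T, such that φ cannot be extended to a d-defective coloring ψ of H with ψ(w) ∈ L(w) for all w ∈ V(H) \ T and λ_H(u_i, ψ) = 0 for every i ∈ {1, …, t}. (ii) If d ≥ 1, then for every precoloring φ of T using t distinct colors and every list assignment L of V(H) \ T with |L(w)| ≥ k for all w, φ extends to a d-defective coloring ψ of H with ψ(w) ∈ L(w) for all w ∈ V(H) \ T, λ_H(u_i, ψ) = 0 for i = 1, …, t−1, and λ_H(u_t, ψ) ≤ 1. (iii) For every precoloring φ of T using at most t−1 distinct colors and every list assignment L of V(H) \ T with |L(w)| ≥ k for all w, φ extends to a d-defective coloring ψ of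 H with ψ(w) ∈ L(w) for all w ∈ V(H) \ T and λ_H(u_i, ψ) = 0 for every i ∈ {1, …, t}. -/
lemma defect_le_of_subset {V : Type*} {G : SimpleGraph V} {φ : V → ℕ} {v : V} {s : Set V}
    {n : ℕ} (hfin : s.Finite) (hs : s.ncard ≤ n) (h : ∀ w, G.Adj v w → φ w = φ v → w ∈ s) :
    defect G φ v ≤ n :=
  (Set.ncard_le_ncard (fun w hw => h w hw.1 hw.2) hfin).trans hs

lemma defect_eq_zero {V : Type*} {G : SimpleGraph V} {φ : V → ℕ} {v : V}
    (h : ∀ w, G.Adj v w → φ w ≠ φ v) : defect G φ v = 0 :=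
  Nat.le_zero.mp <| defect_le_of_subset Set.finite_empty (by simp) fun w hw e => h w hw e

lemma ncard_le_defect {V : Type*} [Finite V] {G : SimpleGraph V} {φ : V → ℕ} {v : V} {s : Set V}
    (h : ∀ w ∈ s, G.Adj v w ∧ φ w = φ v) : s.ncard ≤ defect G φ v :=
  Set.ncard_le_ncard h (Set.toFinite _)

lemma ne_of_defect_eq_zero {V : Type*} [Finite V] {G : SimpleGraph V} {φ : V → ℕ} {v w : V}
    (h : defect G φ v = 0) (hw : G.Adj v w) : φ w ≠ φ v := by
  intro e
  have := ncard_le_defect (G := G) (φ := φ) (v := v) (s := {w}) (by simpa using ⟨hw, e⟩)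
  simp [h] at this

/-- Lists of size `r` admit a choice of colors in which each color is used at most `n` times,
as long as there are at most `r * n` vertices. -/
lemma exists_choice_card_fiber_le {α : Type*} [DecidableEq α] (r n : ℕ) (F : α → Finset ℕ)
    (s : Finset α) (hF : ∀ a ∈ s, r ≤ (F a).card) (hs : s.card ≤ r * n) :
    ∃ f : α → ℕ, (∀ a ∈ s, f a ∈ F a) ∧ ∀ c, {a ∈ s | f a = c}.card ≤ n := by
  induction s using Finset.induction_on with
  | empty => exact ⟨fun _ => 0, by simp, by simp⟩
  | insert a s ha ih =>
    rw [Finset.card_insert_of_notMem ha] at hs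
    obtain ⟨f, hf, hc⟩ := ih (fun b hb => hF b (Finset.mem_insert_of_mem hb)) (by omega)
    obtain ⟨c, hcF, hcn⟩ : ∃ c ∈ F a, {b ∈ s | f b = c}.card < n := by
      by_contra! hcon
      have h1 : (F a).card * n ≤ s.card := by
        have h2 := Finset.sum_le_sum hcon
        rw [Finset.sum_const, smul_eq_mul] at h2
        refine h2.trans ?_
        rw [← Finset.card_biUnion]
        · exact Finset.card_le_card fun b => by simp +contextual
        · intro x _ y _ hxy
          rw [Function.onFun, Finset.disjoint_left]
          simp only [Finset.mem_filter]
          grind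
      have h3 := Nat.mul_le_mul_right n (hF a (Finset.mem_insert_self _ _))
      omega
    refine ⟨Function.update f a c, ?_, fun x => ?_⟩
    · intro b hb
      rcases Finset.mem_insert.mp hb with rfl | hb
      · simpa
      · rw [Function.update_of_ne (by grind)]
        exact hf b hb
    · have hfil : {b ∈ s | Function.update f a c b = x} = {b ∈ s | f b = x} :=
        Finset.filter_congr fun b hb => by rw [Function.update_of_ne (by grind)]
      rw [Finset.filter_insert, hfil]
      split_ifs with h
      · rw [Function.update_self] at h
        subst h
        exact (Finset.card_insert_le _ _).trans hcn
      · exact hc x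

/-- A path whose lists are at least as large as the degrees, and strictly larger at one
vertex `m`, is list colorable. -/
lemma exists_path_coloring (N m : ℕ) (F : ℕ → Finset ℕ) (hm : m < N)
    (hF : ∀ i < N, (if 0 < i then 1 else 0) + (if i + 1 < N then 1 else 0) +
      (if i = m then 1 else 0) ≤ (F i).card) :
    ∃ f : ℕ → ℕ, (∀ i < N, f i ∈ F i) ∧ ∀ i, i + 1 < N → f i ≠ f (i + 1) := by
  have left : ∀ n ≤ m, ∃ f : ℕ → ℕ, (∀ i < n, f i ∈ F i) ∧ ∀ i, i + 1 < n → f i ≠ f (i + 1) := by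
    intro n hn
    induction n with
    | zero => exact ⟨fun _ => 0, by simp, by simp⟩
    | succ n ih =>
      obtain ⟨f, hf, hne⟩ := ih (by omega)
      obtain ⟨c, hc, hcn⟩ : ∃ c ∈ F n, 0 < n → c ≠ f (n - 1) := by
        have h := hF n (by omega)
        rw [if_pos (show n + 1 < N by omega)] at h
        rcases Nat.eq_zero_or_pos n with rfl | h0
        · obtain ⟨c, hc⟩ := Finset.card_pos.mp (show 0 < (F 0).card by omega)
          exact ⟨c, hc, by simp⟩
        · rw [if_pos h0] at h
          obtain ⟨c, hc, hcne⟩ := Finset.exists_mem_ne (show 1 < (F n).card by omega) (f (n - 1))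
          exact ⟨c, hc, fun _ => hcne⟩
      refine ⟨fun i => if i < n then f i else c, ?_, ?_⟩
      · intro i hi
        grind
      · intro i hi
        have := hne i
        rcases Nat.lt_or_ge (i + 1) n with h | h
        · grind
        · obtain rfl : n = i + 1 := by omega
          grind
  have right : ∀ n, m + 1 + n ≤ N → ∃ f : ℕ → ℕ, (∀ i < N, N - n ≤ i → f i ∈ F i) ∧
      ∀ i, N - n ≤ i → i + 1 < N → f i ≠ f (i + 1) := by
    intro n hn
    induction n with
    | zero => exact ⟨fun _ => 0, by grind, by grind⟩
    | succ n ih =>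
      obtain ⟨f, hf, hne⟩ := ih (by omega)
      obtain ⟨c, hc, hcn⟩ : ∃ c ∈ F (N - (n + 1)), 0 < n → c ≠ f (N - n) := by
        have h := hF (N - (n + 1)) (by omega)
        rw [if_pos (show 0 < N - (n + 1) by omega)] at h
        rcases Nat.eq_zero_or_pos n with rfl | h0
        · obtain ⟨c, hc⟩ := Finset.card_pos.mp (show 0 < (F (N - (0 + 1))).card by omega)
          exact ⟨c, hc, by simp⟩
        · rw [if_pos (show N - (n + 1) + 1 < N by omega)] at h
          obtain ⟨c, hc, hcne⟩ := Finset.exists_mem_ne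
            (show 1 < (F (N - (n + 1))).card by omega) (f (N - n))
          exact ⟨c, hc, fun _ => hcne⟩
      refine ⟨fun i => if i = N - (n + 1) then c else f i, ?_, ?_⟩
      · intro i hi hi'
        have := hf i
        grind
      · intro i hi hi'
        have := hne i
        rcases eq_or_ne i (N - (n + 1)) with h | h
        · have e : i + 1 = N - n := by omega
          simp only [h, if_true]
          rw [← h, e]
          grind
        · grind
  obtain ⟨f, hf, hfne⟩ := left m le_rfl
  obtain ⟨g, hg, hgne⟩ := right (N - (m + 1)) (by omega)
  have hN : N - (N - (m + 1)) = m + 1 := by omega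
  rw [hN] at hg hgne
  obtain ⟨c, hc, hcf, hcg⟩ : ∃ c ∈ F m, (0 < m → c ≠ f (m - 1)) ∧ (m + 1 < N → c ≠ g (m + 1)) := by
    have h := hF m hm
    let X : Finset ℕ := (if 0 < m then {f (m - 1)} else ∅) ∪ (if m + 1 < N then {g (m + 1)} else ∅)
    have hX : X.card < (F m).card := by
      refine (Finset.card_union_le _ _).trans_lt ?_
      split_ifs at h ⊢ <;> simp_all <;> omega
    obtain ⟨c, hc, hcX⟩ := Finset.exists_mem_notMem_of_card_lt_card hX
    refine ⟨c, hc, ?_, ?_⟩ <;> intro h0 e <;> simp [X, h0, e] at hcX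
  refine ⟨fun i => if i < m then f i else if i = m then c else g i, ?_, ?_⟩
  · intro i hi
    have := hf i
    have := hg i hi
    grind
  · intro i hi
    have := hfne i
    have := hgne i
    grind

/-- The properties of a graph `H` with precolored vertices `u` from which the theorem follows:
distinct precolors block the extension for suitable lists, whereas the extension exists as soon
as the color of one precolored vertex `u j` may be reused once or is repeated on another
precolored vertex. -/
def IsBlockingGadget (k t d : ℕ) {V : Type} (H : SimpleGraph V) (u : Fin t → V) : Prop :=
  Function.Injective u ∧
  (∀ i j : Fin t, ¬ H.Adj (u i) (u j)) ∧
  (∀ φ : Fin t → ℕ, Function.Injective φ →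
    (∀ i, φ i ∈ Finset.Icc 1 (k - 2 + t + 1)) →
    ∃ L : V → Finset ℕ,
      (∀ w, w ∉ Set.range u → k ≤ (L w).card ∧ L w ⊆ Finset.Icc 1 (k - 2 + t + 1)) ∧
      ¬ ∃ ψ : V → ℕ, (∀ i, ψ (u i) = φ i) ∧ (∀ w, w ∉ Set.range u → ψ w ∈ L w) ∧
        (∀ w, defect H ψ w ≤ d) ∧ ∀ i, defect H ψ (u i) = 0) ∧
  (∀ φ : Fin t → ℕ, ∀ j : Fin t, (1 ≤ d ∨ ∃ i, i ≠ j ∧ φ i = φ j) →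
    ∀ L : V → Finset ℕ, (∀ w, w ∉ Set.range u → k ≤ (L w).card) →
    ∃ ψ : V → ℕ, (∀ i, ψ (u i) = φ i) ∧ (∀ w, w ∉ Set.range u → ψ w ∈ L w) ∧
      (∀ w, defect H ψ w ≤ d) ∧ (∀ i, i ≠ j → defect H ψ (u i) = 0) ∧
      defect H ψ (u j) ≤ 1 ∧ ((∃ i, i ≠ j ∧ φ i = φ j) → defect H ψ (u j) = 0))

/-- There are `k - 1` colors left for the vertices that are not precolored. -/
lemma exists_spare_colors {k t : ℕ} (hk : 2 ≤ k) {φ : Fin t → ℕ} {s : ℕ} (hs : s ≤ k - 1) :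
    ∃ E ⊆ Finset.Icc 1 (k - 2 + t + 1), E.card = s ∧ ∀ i, φ i ∉ E := by
  have hcard : s ≤ (Finset.Icc 1 (k - 2 + t + 1) \ Finset.univ.image φ).card := by
    have h1 := Finset.le_card_sdiff (Finset.univ.image φ) (Finset.Icc 1 (k - 2 + t + 1))
    have h2 : (Finset.univ.image φ).card ≤ t := Finset.card_image_le.trans (by simp)
    simp only [Nat.card_Icc] at h1
    omega
  obtain ⟨E, hE, hc⟩ := Finset.exists_subset_card_eq hcard
  refine ⟨E, hE.trans Finset.sdiff_subset, hc, fun i hi => ?_⟩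
  have := hE hi
  simp at this

/-- The graph in which an independent set `A` is completely joined to a clique on `B`. -/
def joinClique (A B : Type) : SimpleGraph (A ⊕ B) where
  Adj x y := x ≠ y ∧ (x.isRight ∨ y.isRight)
  symm := ⟨fun _ _ h => ⟨h.1.symm, h.2.symm⟩⟩
  loopless := ⟨fun _ h => h.1 rfl⟩

/-- For at most `k` precolored vertices, joining all of them to one clique works. -/
lemma isBlockingGadget_joinClique {k t d : ℕ} (hk : 2 ≤ k) (ht : 1 ≤ t) (htk : t ≤ k) :
    IsBlockingGadget k t d (joinClique (Fin t) (Fin ((k - t) * (d + 1) + 1))) Sum.inl := by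
  refine ⟨Sum.inl_injective, by simp [joinClique], ?_, ?_⟩
  · intro φ hφ hφk
    obtain ⟨E, hE, hEc, hφE⟩ := exists_spare_colors (φ := φ) hk (show k - t ≤ k - 1 by omega)
    refine ⟨fun _ => Finset.univ.image φ ∪ E, fun w _ => ⟨?_, ?_⟩, ?_⟩
    · rw [Finset.card_union_of_disjoint, Finset.card_image_of_injective _ hφ, hEc,
        Finset.card_univ, Fintype.card_fin]
      · omega
      · rw [Finset.disjoint_left]
        simpa using hφE
    · refine Finset.union_subset ?_ hE
      simpa [Finset.image_subset_iff] using hφk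
    · rintro ⟨ψ, hψu, hψL, hψd, hψ0⟩
      have hmem : ∀ b ∈ (Finset.univ : Finset (Fin ((k - t) * (d + 1) + 1))),
          ψ (Sum.inr b) ∈ E := by
        intro b _
        have := hψL (Sum.inr b) (by simp)
        rcases Finset.mem_union.mp this with h | h
        · obtain ⟨i, -, hi⟩ := Finset.mem_image.mp h
          refine absurd ?_ (ne_of_defect_eq_zero (hψ0 i)
            (show (joinClique _ _).Adj (Sum.inl i) (Sum.inr b) by simp [joinClique]))
          rw [hψu, hi]
        · exact h
      obtain ⟨c, -, hc⟩ := Finset.exists_lt_card_fiber_of_mul_lt_card_of_maps_to hmem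
        (n := d + 1) (by simp [hEc])
      obtain ⟨b, hb⟩ := Finset.card_pos.mp (Nat.zero_lt_of_lt hc)
      have hle := hψd (Sum.inr b)
      have hge := ncard_le_defect (G := joinClique (Fin t) _) (φ := ψ) (v := Sum.inr b)
        (s := ((((Finset.univ.filter fun x => ψ (Sum.inr x) = c).erase b).image Sum.inr :
          Finset (Fin t ⊕ Fin ((k - t) * (d + 1) + 1))) : Set _)) (by
          intro w hw
          simp only [Finset.coe_image, Set.mem_image, Finset.mem_coe, Finset.mem_erase,
            Finset.mem_filter] at hw hb
          obtain ⟨x, hx, rfl⟩ := hw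
          refine ⟨?_, by rw [hx.2.2, hb.2]⟩
          simpa [joinClique] using hx.1.symm)
      rw [Set.ncard_coe_finset, Finset.card_image_of_injective _ Sum.inr_injective,
        Finset.card_erase_of_mem hb] at hge
      omega
  · intro φ j hj L hL
    have hLk : ∀ b, k ≤ (L (Sum.inr b)).card := fun b => hL _ (by simp)
    obtain ⟨f, hfL, hfφ, hfc⟩ : ∃ f : Fin ((k - t) * (d + 1) + 1) → ℕ,
        (∀ b, f b ∈ L (Sum.inr b)) ∧
        (∀ b i, f b = φ i → i = j ∧ 1 ≤ d ∧ (¬ ∃ i, i ≠ j ∧ φ i = φ j) ∧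
          ∀ b', f b' = f b → b' = b) ∧
        ∀ c, {b | f b = c}.ncard ≤ d + 1 := by
      by_cases hbig : ∀ b, k - t + 1 ≤ (L (Sum.inr b) \ Finset.univ.image φ).card
      · obtain ⟨f, hf, hfc⟩ := exists_choice_card_fiber_le (k - t + 1) (d + 1)
          (fun b => L (Sum.inr b) \ Finset.univ.image φ) Finset.univ (fun b _ => hbig b)
          (by simp only [Finset.card_univ, Fintype.card_fin]; linarith)
        refine ⟨f, fun b => (Finset.mem_sdiff.mp (hf b (Finset.mem_univ _))).1, ?_, ?_⟩
        · intro b i hb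
          have := (Finset.mem_sdiff.mp (hf b (Finset.mem_univ _))).2
          simp [hb] at this
        · intro c
          rw [← Finset.coe_filter_univ, Set.ncard_coe_finset]
          exact hfc c
      · push Not at hbig
        obtain ⟨b₀, hb₀⟩ := hbig
        have hsmall : ¬ ∃ s : Finset ℕ, s.card ≤ t - 1 ∧
            L (Sum.inr b₀) \ s ⊆ L (Sum.inr b₀) \ Finset.univ.image φ := by
          rintro ⟨s, hs, hsub⟩
          have h1 := Finset.card_le_card hsub
          have h2 := Finset.le_card_sdiff s (L (Sum.inr b₀))
          have := hLk b₀
          omega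
        have hcard : ((Finset.univ.erase j).image φ).card ≤ t - 1 :=
          Finset.card_image_le.trans (by simp)
        have hco : ¬ ∃ i, i ≠ j ∧ φ i = φ j := by
          rintro ⟨i, hij, hi⟩
          refine hsmall ⟨(Finset.univ.erase j).image φ, hcard, ?_⟩
          refine Finset.sdiff_subset_sdiff subset_rfl ?_
          intro c hc
          simp only [Finset.mem_image, Finset.mem_erase, Finset.mem_univ, true_and] at hc ⊢
          grind
        have hmem : φ j ∈ L (Sum.inr b₀) := by
          by_contra hnot
          refine hsmall ⟨(Finset.univ.erase j).image φ, hcard, ?_⟩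
          intro c
          simp only [Finset.mem_sdiff, Finset.mem_image, Finset.mem_erase, Finset.mem_univ,
            true_and]
          grind
        obtain ⟨f, hf, hfc⟩ := exists_choice_card_fiber_le (k - t) (d + 1)
          (fun b => L (Sum.inr b) \ Finset.univ.image φ) (Finset.univ.erase b₀) (fun b _ => by
            have h1 := Finset.le_card_sdiff (Finset.univ.image φ) (L (Sum.inr b))
            have h2 : (Finset.univ.image φ).card ≤ t := Finset.card_image_le.trans (by simp)
            have := hLk b
            omega) (by simp)
        have hfφ : ∀ b, b ≠ b₀ → ∀ i, f b ≠ φ i := by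
          intro b hb i e
          have := (Finset.mem_sdiff.mp (hf b (by simpa using hb))).2
          simp [e] at this
        refine ⟨fun b => if b = b₀ then φ j else f b, ?_, ?_, ?_⟩
        · intro b
          have := hf b
          grind
        · grind
        · intro c
          by_cases hc : c = φ j
          · refine (Set.ncard_le_ncard (t := {b₀}) ?_ (Set.toFinite _)).trans (by simp)
            intro b
            have := hfφ b
            grind
          · refine le_trans ?_ (hfc c)
            rw [← Set.ncard_coe_finset]
            refine Set.ncard_le_ncard ?_ (Set.toFinite _)
            intro b
            simp
            grind
    have hinl : ∀ i, i ≠ j ∨ (∃ i, i ≠ j ∧ φ i = φ j) →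
        defect (joinClique _ _) (Sum.elim φ f) (Sum.inl i) = 0 := by
      intro i hi
      refine defect_eq_zero ?_
      rintro (a | b) hw
      · simp [joinClique] at hw
      · intro e
        have := hfφ b i e
        grind
    have hinlj : ∀ i, 1 ≤ d → defect (joinClique _ _) (Sum.elim φ f) (Sum.inl i) ≤ 1 := by
      intro i hd
      by_cases hex : ∃ b, f b = φ i
      · obtain ⟨b, hb⟩ := hex
        refine defect_le_of_subset (s := {Sum.inr b}) (Set.toFinite _) (by simp) ?_
        rintro (a | b') hw e
        · simp [joinClique] at hw
        · have := (hfφ b i hb).2.2.2 b' (by simpa [hb] using e)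
          simp [this]
      · rw [defect_eq_zero]
        · simp
        · rintro (a | b') hw e
          · simp [joinClique] at hw
          · exact hex ⟨b', e⟩
    have hle1 : ∀ i, defect (joinClique _ _) (Sum.elim φ f) (Sum.inl i) ≤ 1 ∧
        defect (joinClique _ _) (Sum.elim φ f) (Sum.inl i) ≤ d := by
      intro i
      rcases hj with hd | hco
      · exact ⟨hinlj i hd, (hinlj i hd).trans hd⟩
      · rw [hinl i (Or.inr hco)]
        simp
    refine ⟨Sum.elim φ f, fun _ => rfl, ?_, ?_, fun i hi => hinl i (Or.inl hi), (hle1 j).1,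
      fun h => hinl j (Or.inr h)⟩
    · rintro (a | b) hw
      · simp at hw
      · exact hfL b
    · rintro (a | b)
      · exact (hle1 a).2
      · by_cases hex : ∃ i, f b = φ i
        · obtain ⟨i, hi⟩ := hex
          obtain ⟨rfl, hd, hco, hb⟩ := hfφ b i hi
          refine (defect_le_of_subset (s := {Sum.inl i}) (n := 1) (Set.toFinite _) (by simp)
            ?_).trans hd
          rintro (a | b') hw e
          · simp only [Sum.elim_inl, Sum.elim_inr] at e
            grind
          · simp only [Sum.elim_inr] at e
            obtain rfl := hb b' e
            exact absurd rfl hw.1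
        · refine defect_le_of_subset (s := Sum.inr '' ({x | f x = f b} \ {b})) (Set.toFinite _)
            ?_ ?_
          · rw [Set.ncard_image_of_injective _ Sum.inr_injective,
              Set.ncard_sdiff_singleton_of_mem (show b ∈ {x | f x = f b} from rfl)]
            have := hfc (f b)
            omega
          · rintro (a | b') hw e
            · exact absurd ⟨a, e.symm⟩ hex
            · refine ⟨b', ⟨e, ?_⟩, rfl⟩
              rintro rfl
              exact hw.1 rfl

/-- A vertex with `d` neighbors of its own color forces every other neighbor to avoid it. -/
lemma ne_of_saturated {V : Type*} [Finite V] {G : SimpleGraph V} {ψ : V → ℕ} {d : ℕ} {x y : V}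
    {s : Fin d → V} (hd : defect G ψ x ≤ d) (hs : Function.Injective s)
    (hadj : ∀ i, G.Adj x (s i)) (hcol : ∀ i, ψ (s i) = ψ x) (hy : G.Adj x y)
    (hys : ∀ i, s i ≠ y) : ψ y ≠ ψ x := by
  intro e
  have h := ncard_le_defect (G := G) (φ := ψ) (v := x) (s := insert y (Set.range s)) (by
    rintro w (rfl | ⟨i, rfl⟩)
    · exact ⟨hy, e⟩
    · exact ⟨hadj i, hcol i⟩)
  rw [Set.ncard_insert_of_notMem (by simpa using hys), ← Set.image_univ,
    Set.ncard_image_of_injective _ hs, Set.ncard_univ, Nat.card_eq_fintype_card,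
    Fintype.card_fin] at h
  omega

/-- The vertices of the gadget for many precolored vertices: the precolored ones, the spine
(a path), a hub attached to each spine vertex, and `d` saturating vertices attached to each hub
and each spine vertex. -/
inductive SpineVertex (t N d : ℕ) : Type
  | pre (j : Fin t)
  | hub (i : Fin N)
  | hubSat (i : Fin N) (s : Fin d)
  | spine (i : Fin N)
  | spineSat (i : Fin N) (s : Fin d)

namespace SpineVertex

variable {t N d : ℕ}

noncomputable instance : Fintype (SpineVertex t N d) :=
  Fintype.ofInjective (β := Fin t ⊕ Fin N ⊕ (Fin N × Fin d) ⊕ Fin N ⊕ (Fin N × Fin d))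
    (fun
      | pre j => .inl j
      | hub i => .inr (.inl i)
      | hubSat i s => .inr (.inr (.inl (i, s)))
      | spine i => .inr (.inr (.inr (.inl i)))
      | spineSat i s => .inr (.inr (.inr (.inr (i, s)))))
    (by rintro (_ | _ | _ | _ | _) (_ | _ | _ | _ | _) h <;> simp_all)

/-- The edges of the spine gadget, each in one direction. -/
def Rel (A B : Fin N → Finset (Fin t)) : SpineVertex t N d → SpineVertex t N d → Prop
  | pre j, hub i => j ∈ B i
  | pre j, hubSat i _ => j ∈ B i
  | pre j, spine i => j ∈ A i
  | pre j, spineSat i _ => j ∈ B i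
  | hub i, hubSat i' _ => i = i'
  | spine i, spineSat i' _ => i = i'
  | hub i, spine i' => i = i'
  | spine i, spine i' => (i : ℕ) + 1 = i'
  | _, _ => False

/-- The spine gadget. -/
def graph (A B : Fin N → Finset (Fin t)) : SimpleGraph (SpineVertex t N d) where
  Adj x y := Rel A B x y ∨ Rel A B y x
  symm := ⟨fun _ _ h => h.symm⟩
  loopless := ⟨fun x h => by cases x <;> simp [Rel] at h⟩

lemma exists_blocking_lists {k : ℕ} {A B : Fin N → Finset (Fin t)} (hk : 3 ≤ k) (hkt : k ≤ t)
    (hN : 0 < N) (hB : ∀ i, (B i).card = k - 1) (hAB : ∀ i, A i ⊆ B i)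
    (hA : ∀ i : Fin N, (A i).card + (if 0 < (i : ℕ) then 1 else 0) +
      (if (i : ℕ) + 1 < N then 1 else 0) = k - 1)
    {φ : Fin t → ℕ} (hφ : Function.Injective φ)
    (hφk : ∀ i, φ i ∈ Finset.Icc 1 (k - 2 + t + 1)) :
    ∃ L : SpineVertex t N d → Finset ℕ,
      (∀ w, w ∉ Set.range pre → k ≤ (L w).card ∧ L w ⊆ Finset.Icc 1 (k - 2 + t + 1)) ∧
      ¬ ∃ ψ : SpineVertex t N d → ℕ, (∀ i, ψ (pre i) = φ i) ∧
        (∀ w, w ∉ Set.range pre → ψ w ∈ L w) ∧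
        (∀ w, defect (graph A B) ψ w ≤ d) ∧ ∀ i, defect (graph A B) ψ (pre i) = 0 := by
  obtain ⟨E, hE, hEc, hφE⟩ := exists_spare_colors (φ := φ) (by omega) (show 2 ≤ k - 1 by omega)
  obtain ⟨a, b, hab, rfl⟩ := Finset.card_eq_two.mp hEc
  obtain ⟨e, he, heE⟩ : ∃ e : ℕ → ℕ, (∀ i, e i ≠ e (i + 1)) ∧ ∀ i, e i ∈ ({a, b} : Finset ℕ) :=
    ⟨fun i => if i % 2 = 0 then a else b, fun i => by grind, fun i => by grind⟩
  have heφ : ∀ i j, φ j ≠ e i := fun i j h => hφE j (h ▸ heE i)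
  have hj : ∀ i, ∃ j, j ∉ B i := by
    intro i
    by_contra! h
    have h1 := Finset.card_le_card (show Finset.univ ⊆ B i from fun j _ => h j)
    rw [hB, Finset.card_univ, Fintype.card_fin] at h1
    omega
  choose y hy using hj
  let X : Fin N → Finset ℕ := fun i => (if 0 < (i : ℕ) then {e (i - 1)} else ∅) ∪
    (if (i : ℕ) + 1 < N then {e i} else ∅)
  have hX : ∀ i, (X i).card = (if 0 < (i : ℕ) then 1 else 0) +
      (if (i : ℕ) + 1 < N then 1 else 0) := by
    intro i
    have h1 := he (i - 1)
    simp only [X]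
    rw [Finset.card_union_of_disjoint]
    · split_ifs <;> simp
    · split_ifs with h0
      · rw [Nat.sub_add_cancel h0] at h1
        simpa using h1
      all_goals simp
  have hXE : ∀ i, X i ⊆ {a, b} := by
    intro i c hc
    simp only [X, Finset.mem_union] at hc
    rcases hc with hc | hc <;> split_ifs at hc <;> simp only [Finset.mem_singleton,
      Finset.notMem_empty] at hc <;> exact hc ▸ heE _
  have himg : ∀ s : Finset (Fin t), s.image φ ⊆ Finset.Icc 1 (k - 2 + t + 1) := fun s =>
    Finset.image_subset_iff.mpr fun i _ => hφk i
  have hcardB : ∀ i c, (∀ j ∈ B i, φ j ≠ c) → k ≤ ((B i).image φ ∪ {c}).card := by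
    intro i c hc
    rw [Finset.card_union_of_disjoint, Finset.card_image_of_injective _ hφ, hB,
      Finset.card_singleton]
    · omega
    · simpa using hc
  have hyB : ∀ i, ∀ j ∈ B i, φ j ≠ φ (y i) := fun i j hj h => hy i (hφ h ▸ hj)
  let L : SpineVertex t N d → Finset ℕ
    | pre _ => ∅
    | hub i => (B i).image φ ∪ {φ (y i)}
    | hubSat i _ => (B i).image φ ∪ {φ (y i)}
    | spine i => ((A i).image φ ∪ {φ (y i)}) ∪ X i
    | spineSat i _ => (B i).image φ ∪ {e i}
  refine ⟨L, ?_, ?_⟩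
  · rintro (j | i | ⟨i, s⟩ | i | ⟨i, s⟩) hw
    · simp at hw
    · exact ⟨hcardB i _ (hyB i), Finset.union_subset (himg _) (by simpa using hφk (y i))⟩
    · exact ⟨hcardB i _ (hyB i), Finset.union_subset (himg _) (by simpa using hφk (y i))⟩
    · refine ⟨?_, Finset.union_subset (Finset.union_subset (himg _) (by simpa using hφk (y i)))
        ((hXE i).trans hE)⟩
      simp only [L]
      rw [Finset.card_union_of_disjoint, Finset.card_union_of_disjoint,
        Finset.card_image_of_injective _ hφ, hX, Finset.card_singleton]
      · have := hA i
        omega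
      · simpa using fun j hj => hyB i j (hAB i hj)
      · rw [Finset.disjoint_left]
        intro c hc hcX
        have hcE := hXE i hcX
        simp only [Finset.mem_union, Finset.mem_image, Finset.mem_singleton] at hc
        rcases hc with ⟨j, -, rfl⟩ | rfl <;> exact hφE _ hcE
    · refine ⟨hcardB i _ fun j _ => heφ _ _, Finset.union_subset (himg _) ?_⟩
      exact Finset.singleton_subset_iff.mpr (hE (heE _))
  · rintro ⟨ψ, hψp, hψL, hψd, hψ0⟩
    have hpre : ∀ j w, (graph A B).Adj (pre j) w → ψ w ≠ φ j := fun j w hw =>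
      hψp j ▸ ne_of_defect_eq_zero (hψ0 j) hw
    have hforce : ∀ w i c, w ∉ Set.range pre → L w = (B i).image φ ∪ {c} →
        (∀ j ∈ B i, (graph A B).Adj (pre j) w) → ψ w = c := by
      intro w i c hw hLw hadj
      have h := hψL w hw
      rw [hLw, Finset.mem_union, Finset.mem_image, Finset.mem_singleton] at h
      rcases h with ⟨j, hj, hjw⟩ | h
      · exact absurd hjw.symm (hpre j w (hadj j hj))
      · exact h
    have hhub : ∀ i, ψ (hub i) = φ (y i) := fun i =>
      hforce _ i _ (by simp) rfl fun j hj => Or.inl hj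
    have hhubSat : ∀ i s, ψ (hubSat i s) = φ (y i) := fun i s =>
      hforce _ i _ (by simp) rfl fun j hj => Or.inl hj
    have hspineSat : ∀ i s, ψ (spineSat i s) = e i := fun i s =>
      hforce _ i _ (by simp) rfl fun j hj => Or.inl hj
    have hspine : ∀ i, ψ (spine i) ∈ X i := by
      intro i
      have h := hψL (spine i) (by simp)
      simp only [L, Finset.mem_union, Finset.mem_image, Finset.mem_singleton] at h
      rcases h with (⟨j, hj, hjw⟩ | h) | h
      · exact absurd hjw.symm (hpre j _ (Or.inl hj))
      · refine absurd (h.trans (hhub i).symm) (ne_of_saturated (s := hubSat i) (hψd (hub i))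
          (fun _ _ h => by simpa using h) (fun _ => Or.inl rfl) (fun s => ?_) (Or.inl rfl)
          (by simp))
        rw [hhub, hhubSat]
      · exact h
    have hstep : ∀ i i' : Fin N, (i : ℕ) + 1 = i' → ψ (spine i) = e i → ψ (spine i') ≠ e i := by
      intro i i' hii h
      rw [← h]
      refine ne_of_saturated (s := spineSat i) (hψd (spine i)) (fun _ _ h => by simpa using h)
        (fun _ => Or.inl rfl) (fun s => ?_) (Or.inl hii) (by simp)
      rw [hspineSat, h]
    have hall : ∀ n (hn : n < N), n + 1 < N ∧ ψ (spine ⟨n, hn⟩) = e n := by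
      intro n
      induction n with
      | zero =>
        intro hn
        have h := hspine ⟨0, hn⟩
        simp only [X] at h
        split_ifs at h <;> simp_all
      | succ n ih =>
        intro hn
        have h := hspine ⟨n + 1, hn⟩
        have h' := hstep ⟨n, by omega⟩ ⟨n + 1, hn⟩ rfl (ih (by omega)).2
        simp only [X] at h
        split_ifs at h <;> simp_all
    have := (hall (N - 1) (by omega)).1
    omega

lemma exists_good_extension {k : ℕ} {A B : Fin N → Finset (Fin t)} (hk : 2 ≤ k)
    (hB : ∀ i, (B i).card = k - 1)
    (hA : ∀ i : Fin N, (A i).card + (if 0 < (i : ℕ) then 1 else 0) +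
      (if (i : ℕ) + 1 < N then 1 else 0) = k - 1)
    {φ : Fin t → ℕ} {j : Fin t} {m : Fin N} (hjm : j ∈ B m)
    (hj : 1 ≤ d ∨ ∃ i ∈ B m, i ≠ j ∧ φ i = φ j)
    {L : SpineVertex t N d → Finset ℕ} (hL : ∀ w, w ∉ Set.range pre → k ≤ (L w).card) :
    ∃ ψ : SpineVertex t N d → ℕ, (∀ i, ψ (pre i) = φ i) ∧
      (∀ w, w ∉ Set.range pre → ψ w ∈ L w) ∧
      (∀ w, defect (graph A B) ψ w ≤ d) ∧ (∀ i, i ≠ j → defect (graph A B) ψ (pre i) = 0) ∧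
      defect (graph A B) ψ (pre j) ≤ 1 ∧
      ((∃ i ∈ B m, i ≠ j ∧ φ i = φ j) → defect (graph A B) ψ (pre j) = 0) := by
  have havoid : ∀ w, w ∉ Set.range pre → ∀ i, ∃ c ∈ L w, ∀ j ∈ B i, c ≠ φ j := by
    intro w hw i
    have h1 : ((B i).image φ).card < (L w).card := by
      have h1 := hL w hw
      have h2 := (Finset.card_image_le (s := B i) (f := φ)).trans (hB i).le
      omega
    obtain ⟨c, hc, hcB⟩ := Finset.exists_mem_notMem_of_card_lt_card h1
    refine ⟨c, hc, fun j hj h => hcB ?_⟩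
    exact Finset.mem_image.mpr ⟨j, hj, h.symm⟩
  choose hs hsL hsB using fun i s => havoid (hubSat i s) (by simp) i
  choose vs vsL vsB using fun i s => havoid (spineSat i s) (by simp) i
  choose q₀ hq₀L hq₀B using fun i => havoid (hub i) (by simp) i
  obtain ⟨f, hfF, hf⟩ := exists_path_coloring N m (fun n => if h : n < N then
    L (spine ⟨n, h⟩) \ ((A ⟨n, h⟩).image φ ∪ (if n = m then ∅ else {q₀ ⟨n, h⟩})) else ∅) m.2 (by
      intro n hn
      simp only [hn, dif_pos]
      have h1 := hA ⟨n, hn⟩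
      have h2 := hL (spine ⟨n, hn⟩) (by simp)
      have h3 := Finset.le_card_sdiff
        ((A ⟨n, hn⟩).image φ ∪ (if n = m then ∅ else {q₀ ⟨n, hn⟩})) (L (spine ⟨n, hn⟩))
      have h4 := Finset.card_union_le ((A ⟨n, hn⟩).image φ)
        (if n = m then ∅ else {q₀ ⟨n, hn⟩})
      have h5 := Finset.card_image_le (s := A ⟨n, hn⟩) (f := φ)
      have h6 : (if n = m then (∅ : Finset ℕ) else {q₀ ⟨n, hn⟩}).card =
          1 - (if n = m then 1 else 0) := by split_ifs <;> simp
      simp only at h1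
      generalize (if n = m then (∅ : Finset ℕ) else {q₀ ⟨n, hn⟩}) = Y at *
      split_ifs at h1 h6 ⊢ <;> omega)
  have hfL : ∀ i : Fin N, f i ∈ L (spine i) ∧ (∀ j ∈ A i, f i ≠ φ j) ∧ (i ≠ m → f i ≠ q₀ i) := by
    intro i
    have h := hfF i i.2
    simp only [i.2, dif_pos, Finset.mem_sdiff, Finset.mem_union, not_or, Finset.mem_image,
      not_exists, not_and] at h
    refine ⟨h.1, fun j hj e => h.2.1 j hj e.symm, fun him e => h.2.2 ?_⟩
    rw [if_neg (fun h => him (Fin.ext h))]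
    simpa using e
  obtain ⟨c, hcL, hcf, hcB⟩ : ∃ c ∈ L (hub m), c ≠ f m ∧ ∀ i ∈ B m, i ≠ j → c ≠ φ i := by
    have h1 : (insert (f m) (((B m).erase j).image φ)).card < (L (hub m)).card := by
      have h1 := hL (hub m) (by simp)
      have h2 := Finset.card_insert_le (f m) (((B m).erase j).image φ)
      have h3 := Finset.card_image_le (s := (B m).erase j) (f := φ)
      rw [Finset.card_erase_of_mem hjm, hB] at h3
      omega
    obtain ⟨c, hc, hcB⟩ := Finset.exists_mem_notMem_of_card_lt_card h1
    simp only [Finset.mem_insert, Finset.mem_image, Finset.mem_erase, not_or, not_exists,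
      not_and] at hcB
    exact ⟨c, hc, hcB.1, fun i hi hij e => hcB.2 i ⟨hij, hi⟩ e.symm⟩
  obtain ⟨q, hqL, hqf, hqB⟩ : ∃ q : Fin N → ℕ, (∀ i, q i ∈ L (hub i)) ∧ (∀ i, q i ≠ f i) ∧
      ∀ i, ∀ j' ∈ B i, q i = φ j' →
        i = m ∧ j' = j ∧ ¬ ∃ i ∈ B m, i ≠ j ∧ φ i = φ j := by
    refine ⟨fun i => if i = m then c else q₀ i, ?_, ?_, ?_⟩
    · grind
    · intro i
      have := (hfL i).2.2
      grind
    · intro i j' hj' h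
      have := hq₀B i
      grind
  let ψ : SpineVertex t N d → ℕ
    | pre j => φ j
    | hub i => q i
    | hubSat i s => hs i s
    | spine i => f i
    | spineSat i s => vs i s
  have hpre : ∀ j' w, (graph A B).Adj (pre j') w → ψ w = φ j' →
      w = hub m ∧ j' = j ∧ ¬ ∃ i ∈ B m, i ≠ j ∧ φ i = φ j := by
    rintro j' (j₁ | i | ⟨i, s⟩ | i | ⟨i, s⟩) (hw | hw) e <;> simp only [Rel] at hw
    · obtain ⟨rfl, h⟩ := hqB i j' hw e
      exact ⟨rfl, h⟩
    · exact absurd e (hsB i s j' hw)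
    · exact absurd e ((hfL i).2.1 j' hw)
    · exact absurd e (vsB i s j' hw)
  have hpre1 : ∀ j', defect (graph A B) ψ (pre j') ≤ 1 := fun j' =>
    defect_le_of_subset (s := {hub m}) (Set.toFinite _) (by simp) fun w hw e => (hpre j' w hw e).1
  have hpre0 : ∀ j', (∃ i ∈ B m, i ≠ j ∧ φ i = φ j) → defect (graph A B) ψ (pre j') = 0 :=
    fun j' h => defect_eq_zero fun w hw e => (hpre j' w hw e).2.2 h
  have hrange : ∀ s : Fin d → SpineVertex t N d, (Set.range s).ncard ≤ d := by
    intro s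
    rw [← Set.image_univ]
    exact (Set.ncard_image_le (Set.toFinite _)).trans (by simp [Set.ncard_univ])
  refine ⟨ψ, fun _ => rfl, ?_, ?_, ?_, hpre1 j, hpre0 j⟩
  · rintro (j₁ | i | ⟨i, s⟩ | i | ⟨i, s⟩) hw
    · simp at hw
    · exact hqL i
    · exact hsL i s
    · exact (hfL i).1
    · exact vsL i s
  · rintro (j₁ | i | ⟨i, s⟩ | i | ⟨i, s⟩)
    · rcases hj with hd | h
      · exact (hpre1 j₁).trans hd
      · simp [hpre0 j₁ h]
    · by_cases hex : ∃ j' ∈ B i, q i = φ j'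
      · obtain ⟨j', hj', hqj⟩ := hex
        have hd : 1 ≤ d := hj.resolve_right (hqB i j' hj' hqj).2.2
        refine (defect_le_of_subset (s := {pre j'}) (n := 1) (Set.toFinite _) (by simp) ?_).trans hd
        rintro (j₁ | i' | ⟨i', s⟩ | i' | ⟨i', s⟩) (hw | hw) e <;> simp only [Rel] at hw
        · rw [(hqB i j₁ hw e.symm).2.1, (hqB i j' hj' hqj).2.1]
          rfl
        · subst hw
          exact absurd (e.trans hqj) (hsB i s j' hj')
        · subst hw
          exact absurd e.symm (hqf i)
      · refine defect_le_of_subset (s := Set.range (hubSat i)) (Set.toFinite _) (hrange _) ?_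
        rintro (j₁ | i' | ⟨i', s⟩ | i' | ⟨i', s⟩) (hw | hw) e <;> simp only [Rel] at hw
        · exact absurd ⟨j₁, hw, e.symm⟩ hex
        · subst hw
          exact ⟨s, rfl⟩
        · subst hw
          exact absurd e.symm (hqf i)
    · refine (defect_le_of_subset (s := {hub i}) (n := 1) (Set.toFinite _) (by simp) ?_).trans
        (Nat.one_le_of_lt s.2)
      rintro (j₁ | i' | ⟨i', s⟩ | i' | ⟨i', s⟩) (hw | hw) e <;> simp only [Rel] at hw
      · exact absurd e.symm (hsB i _ j₁ hw)
      · rw [hw]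
        rfl
    · refine defect_le_of_subset (s := Set.range (spineSat i)) (Set.toFinite _) (hrange _) ?_
      rintro (j₁ | i' | ⟨i', s⟩ | i' | ⟨i', s⟩) (hw | hw) e <;> simp only [Rel] at hw
      · exact absurd e.symm ((hfL i).2.1 j₁ hw)
      · subst hw
        exact absurd e (hqf _)
      · have h := hf i (hw ▸ i'.2)
        rw [hw] at h
        exact absurd e.symm h
      · have h := hf i' (hw ▸ i.2)
        rw [hw] at h
        exact absurd e h
      · subst hw
        exact ⟨s, rfl⟩
    · refine (defect_le_of_subset (s := {spine i}) (n := 1) (Set.toFinite _) (by simp) ?_).trans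
        (Nat.one_le_of_lt s.2)
      rintro (j₁ | i' | ⟨i', s⟩ | i' | ⟨i', s⟩) (hw | hw) e <;> simp only [Rel] at hw
      · exact absurd e.symm (vsB i _ j₁ hw)
      · rw [hw]
        rfl
  · exact fun i hij => defect_eq_zero fun w hw e => hij (hpre i w hw e).2.1

end SpineVertex

/-- For at least `k` precolored vertices, a spine whose hubs see every pair of precolored
vertices works. -/
lemma exists_isBlockingGadget_of_ge {k t : ℕ} (d : ℕ) (hk : 3 ≤ k) (hkt : k ≤ t) :
    ∃ (N : ℕ) (A B : Fin N → Finset (Fin t)),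
      IsBlockingGadget k t d (SpineVertex.graph A B : SimpleGraph (SpineVertex t N d))
        SpineVertex.pre := by
  have hBex : ∀ i : Fin (t * t), ∃ s : Finset (Fin t),
      {(finProdFinEquiv.symm i).1, (finProdFinEquiv.symm i).2} ⊆ s ∧ s.card = k - 1 := by
    intro i
    refine Finset.exists_superset_card_eq (Finset.card_le_two.trans (by omega)) ?_
    simp only [Fintype.card_fin]
    omega
  choose B hBsub hB using hBex
  have hpair : ∀ j j', ∃ i, j ∈ B i ∧ j' ∈ B i := by
    intro j j'
    have h := hBsub (finProdFinEquiv (j, j'))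
    rw [Equiv.symm_apply_apply] at h
    exact ⟨_, h (by simp), h (by simp)⟩
  have hAex : ∀ i : Fin (t * t), ∃ s ⊆ B i, s.card = k - 1 -
      ((if 0 < (i : ℕ) then 1 else 0) + (if (i : ℕ) + 1 < t * t then 1 else 0)) := fun i =>
    Finset.exists_subset_card_eq (by rw [hB]; exact Nat.sub_le _ _)
  choose A hAB hAc using hAex
  have hA : ∀ i : Fin (t * t), (A i).card + (if 0 < (i : ℕ) then 1 else 0) +
      (if (i : ℕ) + 1 < t * t then 1 else 0) = k - 1 := by
    intro i
    have := hAc i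
    split_ifs at this ⊢ <;> omega
  refine ⟨t * t, A, B, fun i j h => by simpa using h, ?_, ?_, ?_⟩
  · rintro i j (h | h) <;> exact h
  · exact fun φ hφ hφk => SpineVertex.exists_blocking_lists hk hkt
      (Nat.mul_pos (by omega) (by omega)) hB hAB hA hφ hφk
  · intro φ j hj L hL
    by_cases hco : ∃ i, i ≠ j ∧ φ i = φ j
    · obtain ⟨i, hij, hi⟩ := hco
      obtain ⟨m, him, hjm⟩ := hpair i j
      have hco' : ∃ i ∈ B m, i ≠ j ∧ φ i = φ j := ⟨i, him, hij, hi⟩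
      obtain ⟨ψ, h1, h2, h3, h4, h5, h6⟩ := SpineVertex.exists_good_extension (by omega) hB hA hjm
        (Or.inr hco') hL
      exact ⟨ψ, h1, h2, h3, h4, h5, fun _ => h6 hco'⟩
    · obtain ⟨m, hjm, -⟩ := hpair j j
      obtain ⟨ψ, h1, h2, h3, h4, h5, -⟩ := SpineVertex.exists_good_extension (by omega) hB hA hjm
        (Or.inl (hj.resolve_right hco)) hL
      exact ⟨ψ, h1, h2, h3, h4, h5, fun h => absurd h hco⟩

lemma exists_isBlockingGadget (k t d : ℕ) (hk : 3 ≤ k) (ht : 2 ≤ t) :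
    ∃ (V : Type) (_ : Fintype V) (H : SimpleGraph V) (u : Fin t → V),
      IsBlockingGadget k t d H u := by
  rcases le_total t k with h | h
  · exact ⟨_, inferInstance, _, _, isBlockingGadget_joinClique (by omega) (by omega) h⟩
  · obtain ⟨N, A, B, hG⟩ := exists_isBlockingGadget_of_ge d hk h
    exact ⟨_, inferInstance, _, _, hG⟩

/-- For all integers `k ≥ 3`, `t ≥ 2`, `d ≥ 0`, with `ℓ = k - 2 + t`, there exists a finite
simple graph `H` with an independent set `T = {u 0, …, u (t-1)}` of `t` vertices such that:
(i) for every precoloring `φ` of `T` with `t` distinct colors from `{1, …, ℓ+1}` there is a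
`k`-list assignment `L` of `H - T` with lists inside `{1, …, ℓ+1}` such that `φ` has no
extension to a `d`-defective coloring `ψ` of `H` from the lists with `λ_H(u i, ψ) = 0` for
all `i`; (ii) if `d ≥ 1`, every precoloring of `T` with `t` distinct colors extends, for
every `k`-list assignment of `H - T`, to a `d`-defective coloring `ψ` with
`λ_H(u i, ψ) = 0` for `i < t - 1` and `λ_H(u (t-1), ψ) ≤ 1`; (iii) every precoloring of `T`
with at most `t - 1` distinct colors extends, for every `k`-list assignment of `H - T`, to
a `d`-defective coloring `ψ` with `λ_H(u i, ψ) = 0` for all `i`. -/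
theorem statement11 (k t d : ℕ) (hk : 3 ≤ k) (ht : 2 ≤ t) :
    ∃ (V : Type) (_ : Fintype V) (H : SimpleGraph V) (u : Fin t → V),
      Function.Injective u ∧
      (∀ i j : Fin t, ¬ H.Adj (u i) (u j)) ∧
      -- (i)
      (∀ φ : Fin t → ℕ, Function.Injective φ →
        (∀ i, φ i ∈ Finset.Icc 1 (k - 2 + t + 1)) →
        ∃ L : V → Finset ℕ,
          (∀ w, w ∉ Set.range u → k ≤ (L w).card ∧ L w ⊆ Finset.Icc 1 (k - 2 + t + 1)) ∧
          ¬ ∃ ψ : V → ℕ, (∀ i, ψ (u i) = φ i) ∧ (∀ w, w ∉ Set.range u → ψ w ∈ L w) ∧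
            (∀ w, defect H ψ w ≤ d) ∧ ∀ i, defect H ψ (u i) = 0) ∧
      -- (ii)
      (1 ≤ d → ∀ φ : Fin t → ℕ, Function.Injective φ →
        ∀ L : V → Finset ℕ, (∀ w, w ∉ Set.range u → k ≤ (L w).card) →
        ∃ ψ : V → ℕ, (∀ i, ψ (u i) = φ i) ∧ (∀ w, w ∉ Set.range u → ψ w ∈ L w) ∧
          (∀ w, defect H ψ w ≤ d) ∧
          (∀ i : Fin t, (i : ℕ) < t - 1 → defect H ψ (u i) = 0) ∧
          defect H ψ (u ⟨t - 1, by omega⟩) ≤ 1) ∧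
      -- (iii)
      (∀ φ : Fin t → ℕ, (Finset.univ.image φ).card ≤ t - 1 →
        ∀ L : V → Finset ℕ, (∀ w, w ∉ Set.range u → k ≤ (L w).card) →
        ∃ ψ : V → ℕ, (∀ i, ψ (u i) = φ i) ∧ (∀ w, w ∉ Set.range u → ψ w ∈ L w) ∧
          (∀ w, defect H ψ w ≤ d) ∧ ∀ i, defect H ψ (u i) = 0) := by
  obtain ⟨V, hV, H, u, hu, hind, hblock, hext⟩ := exists_isBlockingGadget k t d hk ht
  refine ⟨V, hV, H, u, hu, hind, hblock, ?_, ?_⟩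
  · intro hd φ _ L hL
    obtain ⟨ψ, h1, h2, h3, h4, h5, -⟩ := hext φ ⟨t - 1, by omega⟩ (Or.inl hd) L hL
    refine ⟨ψ, h1, h2, h3, fun i hi => h4 i ?_, h5⟩
    rintro rfl
    exact lt_irrefl _ hi
  · intro φ hφ L hL
    obtain ⟨i, j, hij, hne⟩ : ∃ i j, φ i = φ j ∧ i ≠ j := by
      by_contra! h
      rw [Finset.card_image_of_injective _ fun i j => h i j, Finset.card_univ,
        Fintype.card_fin] at hφ
      omega
    have hco : ∃ i, i ≠ j ∧ φ i = φ j := ⟨i, hne, hij⟩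
    obtain ⟨ψ, h1, h2, h3, h4, -, h6⟩ := hext φ j (Or.inr hco) L hL
    refine ⟨ψ, h1, h2, h3, fun i => ?_⟩
    rcases eq_or_ne i j with rfl | hi
    · exact h6 hco
    · exact h4 i hi
end
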